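/- arXiv:1906.06976 — 2 statements merged into one kernel-verified Lean document; each statement's English description precedes it below -/
import Mathlib

section
/- Toymodel with a single negative correlation: Let d ≥ 1 and fix two nearest-neighbour sites i₁, i₂ (|i₁−i₂|₁ = 1). Let T be the symmetric matrix with T_{jj} = 1 for all j, T_{i₁i₂} = T_{i₂i₁} = −δ² for 0 < δ < 1, and all other entries 0; let {W_k} be i.i.d. standard Cauchy, V_j = Σ_k T_{jk}W_k, and H_Λ = −Δ + λV on a finite cube Λ ∋ i₁, i₂. Then there exist constants c > 0 and C₁, C₂ > 0 (depending only on d and E) such that for all λ > 0, all 0 < δ < c(1+λ^{−1})^{−1}, and all such cubes Λ: the limit lim_{ε→0⁺} E[Tr((E+iε)·1_Λ − H_Λ)^{−1}] exists and satisfies | lim_{ε→0⁺} E[Tr((E+iε)·1_Λ − H_Λ)^{−1}] − Tr(E·1_Λ + iλT̂ − H₀)^{−1} | ≤ |Tr(E·1_Λ + iλT̂ − H₀)^{−1}| · ( C₁ (δ(1+λ^{−1}))² + C₂ |Λ|^{−1} ), where H₀ = −Δ and T̂ is the diagonal matrix with T̂_{jj} = Σ_k T_{jk} (so T̂_{jj}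 = 1 for j ∉ {i₁,i₂} and T̂_{jj} = 1 − δ² for j ∈ {i₁,i₂}). -/
open MeasureTheory Matrix Filter

noncomputable section

/-- ℓ¹ distance on ℤ^d. -/
def dist1 {d : ℕ} (x y : Fin d → ℤ) : ℤ := ∑ i, |x i - y i|

/-- The cube [-L, L]^d in ℤ^d, centered at the origin. -/
def cube (d L : ℕ) : Finset (Fin d → ℤ) :=
  Finset.Icc (fun _ => -(L : ℤ)) (fun _ => (L : ℤ))

/-- Entries of the discrete Laplacian associated to a finite volume Λ:
`(Δψ)(j) = ∑_{k ∈ Λ, |j-k|₁ = 1} (ψ(k) - ψ(j))`. -/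
def lapE {d : ℕ} (Λ : Finset (Fin d → ℤ)) (j k : Fin d → ℤ) : ℂ :=
  (if dist1 j k = 1 then 1 else 0) -
    (if j = k then ((Λ.filter (fun k' => dist1 j k' = 1)).card : ℂ) else 0)

/-- The discrete Laplacian as a matrix on Λ. -/
def lap {d : ℕ} (Λ : Finset (Fin d → ℤ)) : Matrix Λ Λ ℂ :=
  fun j k => lapE Λ (j : Fin d → ℤ) (k : Fin d → ℤ)

/-- The standard Cauchy probability measure π⁻¹(1+x²)⁻¹ dx on ℝ. -/
def cauchy : Measure ℝ :=
  volume.withDensity (fun x => ENNReal.ofReal (1 / (Real.pi * (1 + x ^ 2))))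

/-- The correlation matrix of the toymodel: `T jj = 1`, `T i₁i₂ = T i₂i₁ = -δ²`,
all other entries `0`. -/
def toyT {d : ℕ} (Λ : Finset (Fin d → ℤ)) (i₁ i₂ : Fin d → ℤ) (δ : ℝ) :
    Matrix Λ Λ ℝ := fun j k =>
  if (j : Fin d → ℤ) = (k : Fin d → ℤ) then 1
  else if ((j : Fin d → ℤ) = i₁ ∧ (k : Fin d → ℤ) = i₂) ∨
          ((j : Fin d → ℤ) = i₂ ∧ (k : Fin d → ℤ) = i₁) then -δ ^ 2
  else 0

/-- The density of the standard Cauchy law, extended to a meromorphic function on `ℂ`. -/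
def rho (z : ℂ) : ℂ := ((Real.pi : ℂ) * (1 + z ^ 2))⁻¹

lemma cauchy_eq_cauchyMeasure : cauchy = ProbabilityTheory.cauchyMeasure 0 1 := by
  rw [ProbabilityTheory.cauchyMeasure_of_scale_ne_zero 0 one_ne_zero]
  unfold cauchy
  congr 1
  ext x
  rw [ProbabilityTheory.cauchyPDF_def, ProbabilityTheory.cauchyPDFReal_def]
  congr 1
  simp
  ring

instance : IsProbabilityMeasure cauchy := by
  rw [cauchy_eq_cauchyMeasure]
  infer_instance

lemma integral_cauchy (g : ℝ → ℂ) : ∫ x, g x ∂cauchy = ∫ x : ℝ, rho x * g x := by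
  unfold cauchy
  rw [integral_withDensity_eq_integral_toReal_smul (by fun_prop) (by simp)]
  refine integral_congr_ae (Eventually.of_forall fun x => ?_)
  have : (0 : ℝ) ≤ 1 / (Real.pi * (1 + x ^ 2)) := by positivity
  simp only [ENNReal.toReal_ofReal this, rho, Complex.real_smul]
  push_cast
  ring

/-- If `G` is holomorphic near a closed horizontal strip and decays quadratically there, its
integrals along the two boundary lines agree. -/
lemma integral_horizontal_shift {G : ℂ → ℂ} {a b C : ℝ} (hab : a ≤ b)
    (hG : ∀ z : ℂ, a ≤ z.im → z.im ≤ b → DifferentiableAt ℂ G z)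
    (hC : ∀ z : ℂ, a ≤ z.im → z.im ≤ b → ‖G z‖ ≤ C / (1 + z.re ^ 2)) :
    ∫ t : ℝ, G (t + a * Complex.I) = ∫ t : ℝ, G (t + b * Complex.I) := by
  have hint : ∀ c : ℝ, a ≤ c → c ≤ b → Integrable fun t : ℝ => G (t + c * Complex.I) := by
    intro c hac hcb
    refine (integrable_inv_one_add_sq.const_mul C).mono' ?_ (Eventually.of_forall fun t => ?_)
    · refine Continuous.aestronglyMeasurable ?_
      refine continuous_iff_continuousAt.2 fun t => ?_
      have := (hG (t + c * Complex.I) (by simpa) (by simpa)).continuousAt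
      exact ContinuousAt.comp (f := fun t : ℝ => (t + c * Complex.I : ℂ)) this (by fun_prop)
    · simpa [div_eq_mul_inv] using hC (t + c * Complex.I) (by simpa) (by simpa)
  have hlim : ∀ c : ℝ, a ≤ c → c ≤ b → Tendsto (fun R : ℝ => ∫ t in (-R)..R, G (t + c * Complex.I))
      atTop (nhds (∫ t : ℝ, G (t + c * Complex.I))) := fun c h1 h2 =>
    intervalIntegral_tendsto_integral (hint c h1 h2) tendsto_neg_atTop_atBot tendsto_id
  have hside : ∀ s : ℝ → ℝ, (∀ R, s R ^ 2 = R ^ 2) →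
      Tendsto (fun R : ℝ => Complex.I • ∫ y in a..b, G ((s R : ℝ) + y * Complex.I)) atTop
        (nhds 0) := by
    intro s hs
    have h0 : Tendsto (fun R : ℝ => C / (1 + R ^ 2) * |b - a|) atTop (nhds 0) := by
      rw [← zero_mul |b - a|]
      refine Tendsto.mul_const _ (Tendsto.div_atTop tendsto_const_nhds ?_)
      exact tendsto_atTop_add_const_left _ _ (tendsto_pow_atTop two_ne_zero)
    refine squeeze_zero_norm (fun R => ?_) h0
    rw [norm_smul, Complex.norm_I, one_mul]
    refine intervalIntegral.norm_integral_le_of_norm_le_const fun y hy => ?_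
    rw [Set.uIoc_of_le hab] at hy
    have := hC (s R + y * Complex.I) (by simpa using hy.1.le) (by simpa using hy.2)
    simpa [hs R] using this
  have hrect : ∀ R : ℝ, (∫ t in (-R)..R, G (t + a * Complex.I)) -
      (∫ t in (-R)..R, G (t + b * Complex.I)) +
      (Complex.I • ∫ y in a..b, G ((R : ℝ) + y * Complex.I)) -
      (Complex.I • ∫ y in a..b, G ((-R : ℝ) + y * Complex.I)) = 0 := by
    intro R
    have := Complex.integral_boundary_rect_eq_zero_of_differentiableOn G
      (((-R : ℝ) : ℂ) + a * Complex.I) ((R : ℂ) + b * Complex.I) (by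
        intro z hz
        simp only [Complex.mem_reProdIm] at hz
        have h2 := hz.2
        simp only [Complex.add_im, Complex.ofReal_im, Complex.mul_im, Complex.ofReal_re,
          Complex.I_im, Complex.I_re, mul_one, mul_zero, add_zero, zero_add,
          Set.uIcc_of_le hab] at h2
        exact (hG z h2.1 h2.2).differentiableWithinAt)
    simpa using this
  have hfin := (((hlim a le_rfl hab).sub (hlim b hab le_rfl)).add
    (hside (fun R => R) (by simp))).sub (hside (fun R => -R) (by simp))
  simp only [hrect] at hfin
  have := tendsto_nhds_unique hfin tendsto_const_nhds
  simpa [sub_eq_zero] using this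

lemma rho_factor (z : ℂ) :
    rho z = ((Real.pi : ℂ))⁻¹ * ((z + Complex.I)⁻¹ * (z - Complex.I)⁻¹) := by
  rw [rho, ← mul_inv, ← mul_inv]
  congr 2
  linear_combination Complex.I_sq

lemma rho_differentiableAt {z : ℂ} (h1 : z.im ≠ 1) (h2 : z.im ≠ -1) :
    DifferentiableAt ℂ rho z := by
  have e1 : z + Complex.I ≠ 0 := fun h => h2 (by
    have := congrArg Complex.im h; simp at this; linarith)
  have e2 : z - Complex.I ≠ 0 := fun h => h1 (by
    have := congrArg Complex.im h; simp at this; linarith)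
  have : rho = fun z => ((Real.pi : ℂ))⁻¹ * ((z + Complex.I)⁻¹ * (z - Complex.I)⁻¹) :=
    funext rho_factor
  rw [this]
  fun_prop (disch := assumption)

lemma norm_rho_le_of_sq_le {z : ℂ} {m : ℝ} (hm : 0 < m)
    (h : m ^ 2 ≤ ‖z + Complex.I‖ ^ 2 * ‖z - Complex.I‖ ^ 2) :
    ‖rho z‖ ≤ m⁻¹ := by
  have h1 : m ≤ ‖z + Complex.I‖ * ‖z - Complex.I‖ := by
    rw [← mul_pow] at h
    exact (sq_le_sq₀ hm.le (by positivity)).1 h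
  rw [rho_factor, norm_mul, norm_mul, norm_inv, norm_inv, norm_inv, ← mul_inv, ← mul_inv]
  refine inv_anti₀ hm ?_
  have hpi : (1 : ℝ) ≤ ‖(Real.pi : ℂ)‖ := by
    rw [Complex.norm_real, Real.norm_of_nonneg Real.pi_pos.le]; linarith [Real.pi_gt_three]
  nlinarith

lemma norm_add_I_sq (z : ℂ) : ‖z + Complex.I‖ ^ 2 = z.re ^ 2 + (z.im + 1) ^ 2 := by
  rw [Complex.sq_norm, Complex.normSq_apply]; simp; ring

lemma norm_sub_I_sq (z : ℂ) : ‖z - Complex.I‖ ^ 2 = z.re ^ 2 + (z.im - 1) ^ 2 := by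
  rw [Complex.sq_norm, Complex.normSq_apply]; simp; ring

lemma norm_rho_le_near {z : ℂ} (h1 : -(3 / 4) ≤ z.im) (h2 : z.im ≤ 0) :
    ‖rho z‖ ≤ 4 / (1 + z.re ^ 2) := by
  have h : (1 + z.re ^ 2) / 4 = (4 / (1 + z.re ^ 2))⁻¹ := by rw [inv_div]
  rw [← inv_inv (4 / (1 + z.re ^ 2)), ← h]
  refine norm_rho_le_of_sq_le (by positivity) ?_
  rw [norm_add_I_sq, norm_sub_I_sq]
  have a1 : (1 + z.re ^ 2) / 16 ≤ z.re ^ 2 + (z.im + 1) ^ 2 := by nlinarith [sq_nonneg z.re]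
  have a2 : (1 + z.re ^ 2) ≤ z.re ^ 2 + (z.im - 1) ^ 2 := by nlinarith [sq_nonneg z.re]
  calc ((1 + z.re ^ 2) / 4) ^ 2 = (1 + z.re ^ 2) / 16 * (1 + z.re ^ 2) := by ring
    _ ≤ _ := by gcongr

lemma norm_rho_le_far {z : ℂ} {K : ℝ} (hK : 2 ≤ K) (h : z.im ≤ -K) :
    ‖rho z‖ ≤ ((K / 2) ^ 2 + z.re ^ 2)⁻¹ := by
  refine norm_rho_le_of_sq_le (by positivity) ?_
  rw [norm_add_I_sq, norm_sub_I_sq]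
  have a1 : (K / 2) ^ 2 + z.re ^ 2 ≤ z.re ^ 2 + (z.im + 1) ^ 2 := by nlinarith [sq_nonneg z.re]
  have a2 : (K / 2) ^ 2 + z.re ^ 2 ≤ z.re ^ 2 + (z.im - 1) ^ 2 := by nlinarith [sq_nonneg z.re]
  calc ((K / 2) ^ 2 + z.re ^ 2) ^ 2
      = ((K / 2) ^ 2 + z.re ^ 2) * ((K / 2) ^ 2 + z.re ^ 2) := by ring
    _ ≤ _ := by gcongr

lemma norm_rho_le_far_one {z : ℂ} {K : ℝ} (hK : 2 ≤ K) (h : z.im ≤ -K) :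
    ‖rho z‖ ≤ 1 / (1 + z.re ^ 2) := by
  refine (norm_rho_le_far hK h).trans ?_
  rw [one_div]
  gcongr
  nlinarith

lemma integrable_inv_sq_add_sq {c : ℝ} (hc : 0 < c) :
    Integrable (fun t : ℝ => (c ^ 2 + t ^ 2)⁻¹) ∧ ∫ t : ℝ, (c ^ 2 + t ^ 2)⁻¹ = Real.pi / c := by
  have e : (fun t : ℝ => (c ^ 2 + t ^ 2)⁻¹) = fun t => (c ^ 2)⁻¹ * (1 + (t / c) ^ 2)⁻¹ := by
    ext t; field_simp
  rw [e]
  constructor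
  · exact (integrable_inv_one_add_sq.comp_div hc.ne').const_mul _
  · rw [integral_const_mul, Measure.integral_comp_div (fun t : ℝ => (1 + t ^ 2)⁻¹) c,
      integral_univ_inv_one_add_sq, abs_of_pos hc, smul_eq_mul]
    field_simp

lemma continuous_rho_line {c : ℝ} (h1 : c ≠ 1) (h2 : c ≠ -1) :
    Continuous fun t : ℝ => rho (t + c * Complex.I) := by
  refine continuous_iff_continuousAt.2 fun t => ?_
  exact ContinuousAt.comp (f := fun t : ℝ => (t + c * Complex.I : ℂ))
    (rho_differentiableAt (by simpa) (by simpa)).continuousAt (by fun_prop)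

lemma integral_norm_rho_line_le {K : ℝ} (hK : 2 ≤ K) :
    Integrable (fun t : ℝ => rho (t + (-K : ℝ) * Complex.I)) ∧
      ∫ t : ℝ, ‖rho (t + (-K : ℝ) * Complex.I)‖ ≤ 2 * Real.pi / K := by
  have hb : ∀ t : ℝ, ‖rho (t + (-K : ℝ) * Complex.I)‖ ≤ ((K / 2) ^ 2 + t ^ 2)⁻¹ := fun t => by
    simpa using norm_rho_le_far (z := t + (-K : ℝ) * Complex.I) hK (by simp)
  obtain ⟨hi, hv⟩ := integrable_inv_sq_add_sq (c := K / 2) (by linarith)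
  have hint : Integrable (fun t : ℝ => rho (t + (-K : ℝ) * Complex.I)) :=
    hi.mono' (continuous_rho_line (by linarith) (by linarith)).aestronglyMeasurable
      (Eventually.of_forall hb)
  refine ⟨hint, ?_⟩
  calc _ ≤ ∫ t : ℝ, ((K / 2) ^ 2 + t ^ 2)⁻¹ := integral_mono hint.norm hi hb
    _ = 2 * Real.pi / K := by rw [hv]; field_simp

lemma integral_rho_line_eq_zero {K : ℝ} (hK : 2 ≤ K) :
    ∫ t : ℝ, rho (t + (-K : ℝ) * Complex.I) = 0 := by
  have hlim : Tendsto (fun R : ℝ => 2 * Real.pi / R) atTop (nhds 0) :=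
    tendsto_const_nhds.div_atTop tendsto_id
  refine norm_le_zero_iff.1 (ge_of_tendsto hlim ?_)
  filter_upwards [eventually_ge_atTop K] with R hR
  have := integral_horizontal_shift (G := rho) (a := -R) (b := -K) (C := 1) (by linarith)
    (fun z _ h => rho_differentiableAt (by linarith) (by linarith))
    (fun z _ h => norm_rho_le_far_one hK h)
  rw [← this]
  exact (norm_integral_le_integral_norm _).trans (integral_norm_rho_line_le (hK.trans hR)).2

lemma integrable_rho_line_near {a : ℝ} (ha : 0 ≤ a) (ha' : a ≤ 3 / 4) :
    Integrable fun t : ℝ => rho (t + (-a : ℝ) * Complex.I) := by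
  refine (integrable_inv_one_add_sq.const_mul 4).mono'
    (continuous_rho_line (by linarith) (by linarith)).aestronglyMeasurable
    (Eventually.of_forall fun t => ?_)
  simpa [div_eq_mul_inv] using norm_rho_le_near (z := t + (-a : ℝ) * Complex.I) (by simpa)
    (by simpa)

lemma integral_rho_line_near {a : ℝ} (ha : 0 ≤ a) (ha' : a ≤ 3 / 4) :
    ∫ t : ℝ, rho (t + (-a : ℝ) * Complex.I) = 1 := by
  have h := integral_horizontal_shift (G := rho) (a := -a) (b := 0) (C := 4) (by linarith)
    (fun z h1 h2 => rho_differentiableAt (by linarith) (by linarith))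
    (fun z h1 h2 => norm_rho_le_near (by linarith) h2)
  rw [h]
  have := integral_cauchy (fun _ => 1)
  simpa using this.symm

/-- Moving a Cauchy integral of a bounded holomorphic function down past the pole `-i`. -/
lemma integral_rho_mul_shift {g : ℂ → ℂ} {a K M : ℝ} (ha : 0 ≤ a) (ha' : a ≤ 3 / 4) (hK : 2 ≤ K)
    (hg : ∀ z : ℂ, -K ≤ z.im → z.im ≤ -a → DifferentiableAt ℂ g z)
    (hM : ∀ z : ℂ, -K ≤ z.im → z.im ≤ -a → ‖g z‖ ≤ M) :
    ∫ t : ℝ, g (t + (-a : ℝ) * Complex.I) * rho (t + (-a : ℝ) * Complex.I) =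
      g (-Complex.I) +
        ∫ t : ℝ, g (t + (-K : ℝ) * Complex.I) * rho (t + (-K : ℝ) * Complex.I) := by
  have hline : ∀ c : ℝ, -K ≤ c → c ≤ -a → c ≠ -1 →
      Integrable (fun t : ℝ => rho (t + c * Complex.I)) →
      Integrable fun t : ℝ => g (t + c * Complex.I) * rho (t + c * Complex.I) := by
    intro c h1 h2 h3 hi
    refine hi.bdd_mul (c := M) ?_ (Eventually.of_forall fun t => hM _ (by simpa) (by simpa))
    refine Continuous.aestronglyMeasurable (continuous_iff_continuousAt.2 fun t => ?_)
    exact ContinuousAt.comp (f := fun t : ℝ => (t + c * Complex.I : ℂ))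
      (hg _ (by simpa) (by simpa)).continuousAt (by fun_prop)
  have hia := hline (-a) (by linarith) le_rfl (by linarith) (integrable_rho_line_near ha ha')
  have hiK := hline (-K) le_rfl (by linarith) (by linarith) (integral_norm_rho_line_le hK).1
  set G : ℂ → ℂ := fun z => (Real.pi : ℂ)⁻¹ * (dslope g (-Complex.I) z * (z - Complex.I)⁻¹)
    with hGdef
  have hGeq : ∀ z : ℂ, z.im ≠ -1 → G z = g z * rho z - g (-Complex.I) * rho z := by
    intro z hz
    have hne : z ≠ -Complex.I := fun h => hz (by simp [h])
    simp only [hGdef]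
    rw [dslope_of_ne _ hne, slope_def_field, rho_factor, sub_neg_eq_add]
    ring
  have hGd : ∀ z : ℂ, -K ≤ z.im → z.im ≤ -a → DifferentiableAt ℂ G z := by
    intro z h1 h2
    have e2 : z - Complex.I ≠ 0 := fun h => by
      have := congrArg Complex.im h; simp at this; linarith
    have hd : DifferentiableAt ℂ (dslope g (-Complex.I)) z := by
      by_cases hz : z = -Complex.I
      · have ho : IsOpen {w : ℂ | -K < w.im ∧ w.im < -a} :=
          (isOpen_lt continuous_const Complex.continuous_im).inter
            (isOpen_lt Complex.continuous_im continuous_const)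
        have hmem : {w : ℂ | -K < w.im ∧ w.im < -a} ∈ nhds (-Complex.I) :=
          ho.mem_nhds ⟨by simp; linarith, by simp; linarith⟩
        rw [hz]
        refine DifferentiableOn.differentiableAt ?_ hmem
        rw [Complex.differentiableOn_dslope hmem]
        exact fun w hw => (hg w hw.1.le hw.2.le).differentiableWithinAt
      · exact (differentiableAt_dslope_of_ne hz).2 (hg z h1 h2)
    simp only [hGdef]
    fun_prop (disch := assumption)
  obtain ⟨C, hC⟩ : ∃ C, ∀ z : ℂ, -K ≤ z.im → z.im ≤ -a → ‖G z‖ ≤ C / (1 + z.re ^ 2) := by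
    have hcomp : IsCompact (Set.Icc (-1 : ℝ) 1 ×ℂ Set.Icc (-K) (-a)) :=
      isCompact_Icc.reProdIm isCompact_Icc
    obtain ⟨C₁, hC₁⟩ := hcomp.exists_bound_of_continuousOn (f := G) fun z hz =>
      (hGd z hz.2.1 hz.2.2).continuousAt.continuousWithinAt
    have hM0 : 0 ≤ M :=
      (norm_nonneg _).trans (hM (-Complex.I) (by simp; linarith) (by simp; linarith))
    have hC₁0 : 0 ≤ C₁ := (norm_nonneg _).trans (hC₁ (-Complex.I)
      ⟨by simp, by simp; constructor <;> linarith⟩)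
    refine ⟨2 * C₁ + 4 * M, fun z h1 h2 => ?_⟩
    have hpos : 0 < 1 + z.re ^ 2 := by positivity
    rw [le_div_iff₀ hpos]
    by_cases hz : z.re ∈ Set.Icc (-1 : ℝ) 1
    · have := hC₁ z ⟨hz, h1, h2⟩
      have h3 : z.re ^ 2 ≤ 1 := by nlinarith [hz.1, hz.2]
      nlinarith [norm_nonneg (G z)]
    · have hre : 1 ≤ z.re ^ 2 := by
        by_contra hcon
        have := abs_le.1 ((sq_le_one_iff_abs_le_one _).1 (not_le.1 hcon).le)
        exact hz ⟨this.1, this.2⟩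
      have hne : z ≠ -Complex.I := fun h => by simp [h] at hre; linarith
      have hb : ‖G z‖ ≤ (M + M) * (z.re ^ 2)⁻¹ := by
        have : G z = (g z - g (-Complex.I)) * rho z := by
          simp only [hGdef]
          rw [dslope_of_ne _ hne, slope_def_field, rho_factor, sub_neg_eq_add]
          ring
        rw [this, norm_mul]
        gcongr
        · exact (norm_sub_le _ _).trans (add_le_add (hM z h1 h2)
            (hM _ (by simp; linarith) (by simp; linarith)))
        · refine norm_rho_le_of_sq_le (by positivity) ?_
          rw [norm_add_I_sq, norm_sub_I_sq, sq (z.re ^ 2)]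
          gcongr <;> nlinarith
      have h5 : (z.re ^ 2)⁻¹ * (1 + z.re ^ 2) ≤ 2 := by
        rw [inv_mul_le_iff₀ (by positivity)]; linarith
      calc ‖G z‖ * (1 + z.re ^ 2) ≤ (M + M) * (z.re ^ 2)⁻¹ * (1 + z.re ^ 2) := by gcongr
        _ = (M + M) * ((z.re ^ 2)⁻¹ * (1 + z.re ^ 2)) := by ring
        _ ≤ (M + M) * 2 := by gcongr
        _ ≤ _ := by linarith
  have key := integral_horizontal_shift (by linarith) hGd hC
  have eK : ∀ t : ℝ, G (t + (-K : ℝ) * Complex.I) = g (t + (-K : ℝ) * Complex.I) *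
      rho (t + (-K : ℝ) * Complex.I) - g (-Complex.I) * rho (t + (-K : ℝ) * Complex.I) :=
    fun t => hGeq _ (by simp; linarith)
  have ea : ∀ t : ℝ, G (t + (-a : ℝ) * Complex.I) = g (t + (-a : ℝ) * Complex.I) *
      rho (t + (-a : ℝ) * Complex.I) - g (-Complex.I) * rho (t + (-a : ℝ) * Complex.I) :=
    fun t => hGeq _ (by simp; linarith)
  simp only [eK, ea] at key
  rw [integral_sub hiK ((integral_norm_rho_line_le hK).1.const_mul _),
    integral_sub hia ((integrable_rho_line_near ha ha').const_mul _),
    integral_const_mul, integral_const_mul, integral_rho_line_eq_zero hK,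
    integral_rho_line_near ha ha'] at key
  linear_combination -key

/-- The Cauchy average of a bounded holomorphic function on the lower half-plane is its value
at `-i`. -/
lemma integral_cauchy_of_lowerHalfPlane {g : ℂ → ℂ} {M : ℝ}
    (hg : ∀ z : ℂ, z.im ≤ 0 → DifferentiableAt ℂ g z) (hM : ∀ z : ℂ, z.im ≤ 0 → ‖g z‖ ≤ M) :
    ∫ x : ℝ, g x ∂cauchy = g (-Complex.I) := by
  have hM0 : 0 ≤ M := (norm_nonneg _).trans (hM 0 (by simp))
  have hlim : Tendsto (fun R : ℝ => M * (2 * Real.pi / R)) atTop (nhds 0) := by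
    rw [← mul_zero M]
    exact (tendsto_const_nhds.div_atTop tendsto_id).const_mul M
  rw [← sub_eq_zero]
  refine norm_le_zero_iff.1 (ge_of_tendsto hlim ?_)
  filter_upwards [eventually_ge_atTop 2] with R hR
  have h := integral_rho_mul_shift (g := g) (a := 0) (K := R) (M := M) le_rfl (by norm_num) hR
    (fun z _ h2 => hg z (by linarith)) (fun z _ h2 => hM z (by linarith))
  have e : ∫ x : ℝ, g x ∂cauchy =
      ∫ t : ℝ, g (t + (-0 : ℝ) * Complex.I) * rho (t + (-0 : ℝ) * Complex.I) := by
    rw [integral_cauchy]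
    simp [mul_comm]
  rw [e, h, add_sub_cancel_left]
  obtain ⟨hi, hv⟩ := integral_norm_rho_line_le hR
  calc _ ≤ ∫ t : ℝ, M * ‖rho (t + (-R : ℝ) * Complex.I)‖ := by
        refine norm_integral_le_of_norm_le (hi.norm.const_mul M) (Eventually.of_forall fun t => ?_)
        rw [norm_mul]
        gcongr
        exact hM _ (by simp; linarith)
    _ ≤ _ := by rw [integral_const_mul]; gcongr

lemma integrable_shear {k : ℝ → ℝ} (hk : Integrable k) (hkc : Continuous k) (a : ℝ) :
    Integrable (fun p : ℝ × ℝ => k p.1 * (1 + (p.2 + a * p.1) ^ 2)⁻¹) ∧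
      ∫ p : ℝ × ℝ, k p.1 * (1 + (p.2 + a * p.1) ^ 2)⁻¹ = (∫ s, k s) * Real.pi := by
  have hc : Continuous fun p : ℝ × ℝ => k p.1 * (1 + (p.2 + a * p.1) ^ 2)⁻¹ := by
    refine (hkc.comp continuous_fst).mul (Continuous.inv₀ (by fun_prop) fun p => ?_)
    positivity
  have hin : ∀ s : ℝ, ∫ t : ℝ, (1 + (t + a * s) ^ 2)⁻¹ = Real.pi := fun s => by
    rw [integral_add_right_eq_self (fun t : ℝ => (1 + t ^ 2)⁻¹), integral_univ_inv_one_add_sq]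
  have hi : Integrable (fun p : ℝ × ℝ => k p.1 * (1 + (p.2 + a * p.1) ^ 2)⁻¹) := by
    rw [Measure.volume_eq_prod, integrable_prod_iff hc.aestronglyMeasurable]
    refine ⟨Eventually.of_forall fun s => ?_, ?_⟩
    · exact (integrable_inv_one_add_sq.comp_add_right (a * s)).const_mul (k s)
    · have : ∀ s : ℝ, ∫ t : ℝ, ‖k s * (1 + (t + a * s) ^ 2)⁻¹‖ = ‖k s‖ * Real.pi := by
        intro s
        rw [← hin s, ← integral_const_mul]
        refine integral_congr_ae (Eventually.of_forall fun t => ?_)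
        have : (0 : ℝ) ≤ (1 + (t + a * s) ^ 2)⁻¹ := by positivity
        simp only [norm_mul, Real.norm_of_nonneg this]
      simp only [this]
      exact hk.norm.mul_const _
  refine ⟨hi, ?_⟩
  rw [Measure.volume_eq_prod, integral_prod _ (by rwa [← Measure.volume_eq_prod])]
  simp only [integral_const_mul, hin, integral_mul_const]

/-- Weight of the two-dimensional remainder after both contour shifts. -/
def shearWeight (K a : ℝ) (p : ℝ × ℝ) : ℂ :=
  rho (p.1 + (-K : ℝ) * Complex.I) *
    rho ((p.2 + a * p.1 : ℝ) + (-(3 / 4) : ℝ) * Complex.I)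

lemma continuous_shearWeight {K : ℝ} (hK : 2 ≤ K) (a : ℝ) : Continuous (shearWeight K a) := by
  refine Continuous.mul ?_ ?_
  · exact (continuous_rho_line (by linarith) (by linarith)).comp continuous_fst
  · exact (continuous_rho_line (c := -(3 / 4)) (by norm_num) (by norm_num)).comp
      (by fun_prop : Continuous fun p : ℝ × ℝ => p.2 + a * p.1)

lemma integrable_shearWeight {K : ℝ} (hK : 2 ≤ K) (a : ℝ) :
    Integrable (shearWeight K a) ∧ ∫ p, ‖shearWeight K a p‖ ≤ 4 * Real.pi * (2 * Real.pi / K) := by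
  obtain ⟨hi, hv⟩ := integral_norm_rho_line_le hK
  obtain ⟨h1, h2⟩ := integrable_shear hi.norm
    (continuous_rho_line (c := -K) (by linarith) (by linarith)).norm a
  have hb : ∀ p : ℝ × ℝ, ‖shearWeight K a p‖ ≤
      4 * (‖rho (p.1 + (-K : ℝ) * Complex.I)‖ * (1 + (p.2 + a * p.1) ^ 2)⁻¹) := by
    intro p
    rw [shearWeight, norm_mul, mul_left_comm]
    gcongr
    simpa [div_eq_mul_inv] using
      norm_rho_le_near (z := (p.2 + a * p.1 : ℝ) + (-(3 / 4) : ℝ) * Complex.I) (by simp)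
        (by simp; norm_num)
  have hint := (h1.const_mul 4).mono' (continuous_shearWeight hK a).aestronglyMeasurable
    (Eventually.of_forall hb)
  refine ⟨hint, (integral_mono hint.norm (h1.const_mul 4) hb).trans ?_⟩
  rw [integral_const_mul, h2]
  nlinarith [Real.pi_pos]

/-- Two-dimensional contour shift for a pair of independent Cauchy variables with a small negative
correlation `a`. -/
lemma integral_cauchy_negative_pair {φ : ℂ × ℂ → ℂ} {M a K : ℝ} (ha : 0 < a) (ha' : a ≤ 1 / 16)
    (hK : 2 * a * K = 1)
    (hφ : ∀ p : ℂ × ℂ, p.1.im ≤ 0 → p.2.im ≤ 0 → DifferentiableAt ℂ φ p)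
    (hM : ∀ p : ℂ × ℂ, p.1.im ≤ 0 → p.2.im ≤ 0 → ‖φ p‖ ≤ M) :
    ∫ x : ℝ, ∫ y : ℝ, φ ((x - a * y : ℝ), (y - a * x : ℝ)) ∂cauchy ∂cauchy =
      φ (-Complex.I * (1 - a), -Complex.I * (1 - a)) +
      (∫ t : ℝ, φ (-Complex.I - a * (t + (-K : ℝ) * Complex.I),
        t + (-K : ℝ) * Complex.I + a * Complex.I) * rho (t + (-K : ℝ) * Complex.I)) +
      ∫ p : ℝ × ℝ, φ ((p.1 + (-K : ℝ) * Complex.I) -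
          a * ((p.2 + a * p.1 : ℝ) + (-(3 / 4) : ℝ) * Complex.I),
        p.2 + (-(1 / 4) : ℝ) * Complex.I) * shearWeight K a p := by
  have hK8 : 8 ≤ K := by nlinarith
  have hK2 : 2 ≤ K := by linarith
  have hM0 : 0 ≤ M := (norm_nonneg _).trans (hM 0 (by simp) (by simp))
  -- the integrand in the variables `x` and `v = y - a x`
  set g : ℂ → ℂ → ℂ := fun v x => φ (x - a * (v + a * x), v) * rho (v + a * x) with hg
  set h : ℂ → ℂ := fun y => φ (-Complex.I - a * y, y + a * Complex.I) with hh
  have hstart : ∫ x : ℝ, ∫ y : ℝ, φ ((x - a * y : ℝ), (y - a * x : ℝ)) ∂cauchy ∂cauchy =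
      ∫ x : ℝ, ∫ v : ℝ, g v x * rho x := by
    rw [integral_cauchy]
    refine integral_congr_ae (Eventually.of_forall fun x => ?_)
    simp only []
    rw [integral_cauchy, ← integral_add_right_eq_self _ (a * x), ← integral_const_mul]
    refine integral_congr_ae (Eventually.of_forall fun v => ?_)
    simp only [hg]
    push_cast
    rw [add_sub_cancel_right]
    ring
  have gim : ∀ v x : ℂ, (x - a * (v + a * x)).im = x.im - a * (v.im + a * x.im) := by
    intro v x; simp
  have gim' : ∀ v x : ℂ, (v + a * x).im = v.im + a * x.im := by intro v x; simp
  have himx : ∀ x : ℂ, x.im ≤ 0 → x.im - a * (0 + a * x.im) ≤ 0 := by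
    intro x hx
    have h1 : 0 ≤ 1 - a ^ 2 := by nlinarith
    nlinarith [mul_nonneg h1 (neg_nonneg.2 hx)]
  -- continuity of the integrand on horizontal lines
  have hcont : ∀ c e : ℝ, c ≤ 0 → e ≤ 0 → -(3 / 4) ≤ e + a * c → c ≠ -1 →
      c - a * (e + a * c) ≤ 0 →
      Continuous fun p : ℝ × ℝ => g (p.2 + e * Complex.I) (p.1 + c * Complex.I) *
        rho (p.1 + c * Complex.I) := by
    intro c e h1 h2 h3 h4 h5
    have h6 : e + a * c ≤ 0 := by nlinarith
    simp only [hg]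
    refine Continuous.mul (Continuous.mul ?_ ?_) ?_
    · refine continuous_iff_continuousAt.2 fun p => ?_
      refine ContinuousAt.comp (g := φ)
        (f := fun p : ℝ × ℝ => ((p.1 + c * Complex.I) - a * ((p.2 + e * Complex.I) +
          a * (p.1 + c * Complex.I)), p.2 + e * Complex.I)) ?_ (by fun_prop)
      exact (hφ _ (by simpa using h5) (by simpa using h2)).continuousAt
    · have e1 : (fun p : ℝ × ℝ => rho ((p.2 + e * Complex.I) + a * (p.1 + c * Complex.I))) =
        fun p : ℝ × ℝ => rho ((p.2 + a * p.1 : ℝ) + (e + a * c : ℝ) * Complex.I) := by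
        ext p; congr 1; push_cast; ring
      rw [e1]
      exact (continuous_rho_line (by linarith) (by linarith)).comp
        (by fun_prop : Continuous fun p : ℝ × ℝ => p.2 + a * p.1)
    · exact (continuous_rho_line (by linarith) h4).comp continuous_fst
  have hgb : ∀ v x : ℂ, v.im ≤ 0 → -(3 / 4) ≤ v.im + a * x.im → v.im + a * x.im ≤ 0 →
      (x - a * (v + a * x)).im ≤ 0 → ‖g v x‖ ≤ M * 4 * (1 + (v.re + a * x.re) ^ 2)⁻¹ := by
    intro v x h1 h2 h3 h4
    simp only [hg]
    rw [norm_mul, mul_assoc, ← div_eq_mul_inv]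
    gcongr
    · exact hM _ h4 h1
    · simpa using norm_rho_le_near (z := v + a * x) (by rwa [gim']) (by rwa [gim'])
  have hrhob : ∀ c : ℝ, c = 0 ∨ c = -K → ∀ s : ℝ,
      ‖rho (s + c * Complex.I)‖ ≤ 4 * (1 + s ^ 2)⁻¹ := by
    intro c hc s
    rcases hc with rfl | rfl
    · simpa [div_eq_mul_inv] using norm_rho_le_near (z := s + (0 : ℝ) * Complex.I)
        (by simp; norm_num) (by simp)
    · refine (norm_rho_le_far_one (z := s + (-K : ℝ) * Complex.I) hK2 (by simp)).trans ?_
      simp only [Complex.add_re, Complex.ofReal_re, Complex.mul_re, Complex.I_re, mul_zero,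
        Complex.ofReal_im, Complex.I_im, mul_one, sub_self, add_zero, one_div]
      have : (0 : ℝ) ≤ (1 + s ^ 2)⁻¹ := by positivity
      linarith
  have hsh := (integrable_shear (integrable_inv_one_add_sq.const_mul (M * 4 * 4))
    (by
      refine continuous_const.mul (Continuous.inv₀ (by fun_prop) fun s => ?_)
      positivity) a).1
  have hint : ∀ c e : ℝ, (c = 0 ∨ c = -K) → e ≤ 0 → -(3 / 4) ≤ e + a * c →
      c - a * (e + a * c) ≤ 0 →
      Integrable fun p : ℝ × ℝ => g (p.2 + e * Complex.I) (p.1 + c * Complex.I) *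
        rho (p.1 + c * Complex.I) := by
    intro c e hc he h3 h5
    have hc0 : c ≤ 0 := by rcases hc with rfl | rfl <;> linarith
    have hc1 : c ≠ -1 := by rcases hc with rfl | rfl <;> linarith
    refine hsh.mono' (hcont c e hc0 he h3 hc1 h5).aestronglyMeasurable
      (Eventually.of_forall fun p => ?_)
    rw [norm_mul]
    have b1 := hgb (p.2 + e * Complex.I) (p.1 + c * Complex.I) (by simpa) (by simpa)
      (by simp; nlinarith) (by simpa using h5)
    have b2 := hrhob c hc p.1
    calc _ ≤ (M * 4 * (1 + (p.2 + a * p.1) ^ 2)⁻¹) * (4 * (1 + p.1 ^ 2)⁻¹) := by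
          refine mul_le_mul (by simpa using b1) b2 (norm_nonneg _) (by positivity)
      _ = _ := by ring
  have hint0 : Integrable fun p : ℝ × ℝ => g p.2 p.1 * rho p.1 := by
    simpa using hint 0 0 (Or.inl rfl) le_rfl (by norm_num) (by simp)
  have hintK : Integrable fun p : ℝ × ℝ => g p.2 (p.1 + (-K : ℝ) * Complex.I) *
      rho (p.1 + (-K : ℝ) * Complex.I) := by
    have := hint (-K) 0 (Or.inr rfl) le_rfl (by nlinarith) (by nlinarith)
    simpa using this
  have hintK' := hint (-K) (-(1 / 4)) (Or.inr rfl) (by norm_num) (by nlinarith) (by nlinarith)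
  rw [Measure.volume_eq_prod] at hint0 hintK hintK'
  -- move `x` down past its pole
  have hx : ∀ v : ℝ, ∫ x : ℝ, g v x * rho x = h (v + (-a : ℝ) * Complex.I) *
      rho (v + (-a : ℝ) * Complex.I) +
      ∫ s : ℝ, g v (s + (-K : ℝ) * Complex.I) * rho (s + (-K : ℝ) * Complex.I) := by
    intro v
    have := integral_rho_mul_shift (g := g v) (a := 0) (K := K) (M := M * 4) le_rfl (by norm_num)
      hK2 (fun x h1 h2 => by
        have h2 : x.im ≤ 0 := by linarith
        simp only [hg]
        refine DifferentiableAt.mul ?_ ?_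
        · refine DifferentiableAt.comp (g := φ) x
            (f := fun x : ℂ => (x - a * (v + a * x), (v : ℂ))) (hφ _ ?_ (by simp)) (by fun_prop)
          rw [gim, Complex.ofReal_im]
          exact himx x h2
        · refine DifferentiableAt.comp (g := rho) x (f := fun x : ℂ => (v + a * x : ℂ))
            (rho_differentiableAt ?_ ?_) (by fun_prop) <;>
              rw [gim', Complex.ofReal_im] <;> nlinarith)
      (fun x h1 h2 => by
        have h2 : x.im ≤ 0 := by linarith
        refine (hgb v x (by simp) (by simp; nlinarith) (by simp; nlinarith) ?_).trans ?_
        · rw [gim, Complex.ofReal_im]; exact himx x h2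
        · refine mul_le_of_le_one_right (by positivity) (inv_le_one_of_one_le₀ ?_)
          nlinarith [sq_nonneg ((v : ℂ).re + a * x.re)])
    simp only [neg_zero, Complex.ofReal_zero, zero_mul, add_zero] at this
    rw [this]
    congr 1
    simp only [hg, hh]
    have e1 : (v : ℂ) + a * -Complex.I = v + (-a : ℝ) * Complex.I := by push_cast; ring
    rw [e1]
    congr 3
    push_cast
    ring
  -- move the first term down past its pole
  have hy := integral_rho_mul_shift (g := h) (a := a) (K := K) (M := M) ha.le (by linarith) hK2
    (fun y h1 h2 => by
      simp only [hh]
      refine DifferentiableAt.comp (g := φ) y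
        (f := fun y : ℂ => (-Complex.I - a * y, y + a * Complex.I)) (hφ _ ?_ ?_) (by fun_prop)
      · simp; nlinarith
      · simp; linarith)
    (fun y h1 h2 => hM _ (by simp; nlinarith) (by simp; linarith))
  -- move `v` down in the second term
  have hv : ∀ s : ℝ, ∫ v : ℝ, g v (s + (-K : ℝ) * Complex.I) * rho (s + (-K : ℝ) * Complex.I) =
      ∫ v : ℝ, g (v + (-(1 / 4) : ℝ) * Complex.I) (s + (-K : ℝ) * Complex.I) *
        rho (s + (-K : ℝ) * Complex.I) := by
    intro s
    rw [integral_mul_const, integral_mul_const]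
    congr 1
    have hsim : ∀ v : ℂ, v.im + a * (s + (-K : ℝ) * Complex.I).im = v.im - 1 / 2 := by
      intro v; simp; linarith
    rw [← integral_add_right_eq_self _ (-(a * s))]
    rw [← integral_add_right_eq_self (fun v : ℝ => g (v + (-(1 / 4) : ℝ) * Complex.I) _) (-(a * s))]
    have := integral_horizontal_shift
      (G := fun v => g (v + (-(a * s) : ℝ)) (s + (-K : ℝ) * Complex.I)) (a := -(1 / 4)) (b := 0)
      (C := M * 4) (by norm_num)
      (fun v h1 h2 => by
        simp only [hg]
        refine DifferentiableAt.mul ?_ ?_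
        · refine DifferentiableAt.comp (g := φ) v
            (f := fun v : ℂ => ((s + (-K : ℝ) * Complex.I) - a * ((v + (-(a * s) : ℝ)) +
              a * (s + (-K : ℝ) * Complex.I)), v + (-(a * s) : ℝ)))
              (hφ _ ?_ ?_) (by fun_prop)
          · rw [gim, hsim]; simp; nlinarith
          · simpa using h2
        · refine DifferentiableAt.comp (g := rho) v
            (f := fun v : ℂ => (v + (-(a * s) : ℝ)) + a * (s + (-K : ℝ) * Complex.I))
            (rho_differentiableAt ?_ ?_) (by fun_prop) <;>
            rw [gim', hsim] <;> simp <;> linarith)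
      (fun v h1 h2 => by
        refine (hgb _ _ (by simpa using h2) ?_ ?_ ?_).trans (le_of_eq ?_)
        · rw [hsim]; simp; linarith
        · rw [hsim]; simp; linarith
        · rw [gim, hsim]; simp; nlinarith
        · simp [div_eq_mul_inv])
    rw [Complex.ofReal_zero] at this
    simp only [zero_mul, add_zero] at this
    have e : ∀ v : ℝ, ((v + -(a * s) : ℝ) : ℂ) + (-(1 / 4) : ℝ) * Complex.I =
      v + (-(1 / 4) : ℝ) * Complex.I + (-(a * s) : ℝ) := by intro v; push_cast; ring
    simp only [e]
    rw [this]
    simp only [Complex.ofReal_add]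
  have hha : h (-Complex.I) = φ (-Complex.I * (1 - a), -Complex.I * (1 - a)) := by
    simp only [hh]
    congr 2 <;> ring
  have hI1 : Integrable fun v : ℝ => h (v + (-a : ℝ) * Complex.I) *
      rho (v + (-a : ℝ) * Complex.I) := by
    refine (integrable_rho_line_near ha.le (by linarith)).bdd_mul (c := M) ?_
      (Eventually.of_forall fun t => hM _ (by simp; nlinarith) (by simp))
    refine Continuous.aestronglyMeasurable (continuous_iff_continuousAt.2 fun t => ?_)
    refine ContinuousAt.comp (g := φ)
      (f := fun t : ℝ => (-Complex.I - a * (t + (-a : ℝ) * Complex.I),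
      t + (-a : ℝ) * Complex.I + a * Complex.I)) ?_ (by fun_prop)
    exact (hφ _ (by simp; nlinarith) (by simp)).continuousAt
  rw [hstart, integral_integral_swap hint0]
  simp only [hx]
  rw [integral_add hI1 hintK.integral_prod_right, hy, hha]
  congr 1
  have hsw := integral_integral_swap (f := fun s v : ℝ => g v (s + (-K : ℝ) * Complex.I) *
      rho (s + (-K : ℝ) * Complex.I)) hintK
  rw [← hsw]
  simp only [hv]
  rw [integral_integral hintK', Measure.volume_eq_prod]
  refine integral_congr_ae (Eventually.of_forall fun p => ?_)
  simp only [hg, shearWeight]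
  have e : (p.2 : ℂ) + (-(1 / 4) : ℝ) * Complex.I + a * (p.1 + (-K : ℝ) * Complex.I) =
      (p.2 + a * p.1 : ℝ) + (-(3 / 4) : ℝ) * Complex.I := by
    have : (2 * a * K : ℂ) = 1 := by exact_mod_cast hK
    push_cast
    linear_combination (-Complex.I / 2) * this
  rw [e]
  ring

section ProductMeasure

variable {ι : Type*}

lemma measurePreserving_update_pi_cauchy [Fintype ι] [DecidableEq ι] (k : ι) :
    MeasurePreserving (fun p : (ι → ℝ) × ℝ => Function.update p.1 k p.2)
      ((Measure.pi fun _ => cauchy).prod cauchy) (Measure.pi fun _ => cauchy) := by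
  have hm : Measurable fun p : (ι → ℝ) × ℝ => Function.update p.1 k p.2 := by
    refine measurable_pi_iff.2 fun j => ?_
    by_cases hj : j = k
    · subst hj; simpa using measurable_snd
    · simp only [Function.update_of_ne hj]
      exact (measurable_pi_apply j).comp measurable_fst
  refine ⟨hm, (Measure.pi_eq fun s hs => ?_).symm⟩
  rw [Measure.map_apply hm (MeasurableSet.univ_pi hs)]
  have hpre : (fun p : (ι → ℝ) × ℝ => Function.update p.1 k p.2) ⁻¹' Set.univ.pi s =
      (Set.univ.pi (Function.update s k Set.univ)) ×ˢ s k := by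
    ext p
    simp only [Set.mem_preimage, Set.mem_pi, Set.mem_univ, true_implies, Set.mem_prod]
    constructor
    · intro h
      refine ⟨fun i => ?_, by simpa using h k⟩
      by_cases hi : i = k
      · subst hi; simp
      · simpa [Function.update_of_ne hi] using h i
    · rintro ⟨h1, h2⟩ i
      by_cases hi : i = k
      · subst hi; simpa using h2
      · simpa [Function.update_of_ne hi] using h1 i
  rw [hpre, Measure.prod_prod, Measure.pi_pi, ← Finset.prod_erase_mul _ _ (Finset.mem_univ k),
    ← Finset.prod_erase_mul Finset.univ (fun i => cauchy (s i)) (Finset.mem_univ k)]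
  simp only [Function.update_self, measure_univ, mul_one]
  congr 1
  refine Finset.prod_congr rfl fun i hi => ?_
  rw [Function.update_of_ne (Finset.ne_of_mem_erase hi)]

/-- Integrating out those i.i.d. Cauchy coordinates in which `G` is bounded holomorphic on the lower
half-plane replaces them by `-i`. -/
lemma integral_pi_cauchy_replace [Fintype ι] [DecidableEq ι] {G : (ι → ℂ) → ℂ} {M : ℝ}
    (S : Finset ι)
    (hG : ∀ w : ι → ℂ, (∀ k, (w k).im ≤ 0) → (∀ k, k ∉ S → (w k).im = 0) → DifferentiableAt ℂ G w)
    (hM : ∀ w : ι → ℂ, (∀ k, (w k).im ≤ 0) → (∀ k, k ∉ S → (w k).im = 0) → ‖G w‖ ≤ M) :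
    ∫ W : ι → ℝ, G (fun k => W k) ∂(Measure.pi fun _ => cauchy) =
      ∫ W : ι → ℝ, G (fun k => if k ∈ S then -Complex.I else W k)
        ∂(Measure.pi fun _ => cauchy) := by
  suffices h : ∀ s : Finset ι, s ⊆ S →
      ∫ W : ι → ℝ, G (fun k => W k) ∂(Measure.pi fun _ => cauchy) =
      ∫ W : ι → ℝ, G (fun k => if k ∈ s then -Complex.I else W k) ∂(Measure.pi fun _ => cauchy) from
    h S subset_rfl
  intro s
  induction s using Finset.induction_on with
  | empty => simp
  | insert k s hk ih =>
    intro hs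
    have hkS : k ∈ S := hs (Finset.mem_insert_self k s)
    have hsS : s ⊆ S := (Finset.subset_insert k s).trans hs
    rw [ih hsS]
    set H : (ι → ℝ) → ℂ := fun W => G (fun k => if k ∈ s then -Complex.I else W k) with hH
    have him1 : ∀ W : ι → ℝ, ∀ j, (if j ∈ s then -Complex.I else (W j : ℂ)).im ≤ 0 := by
      intro W j; split_ifs <;> simp
    have him2 : ∀ W : ι → ℝ, ∀ j, j ∉ S → (if j ∈ s then -Complex.I else (W j : ℂ)).im = 0 := by
      intro W j hj; rw [if_neg fun h => hj (hsS h)]; simp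
    have hHc : Continuous H := by
      refine continuous_iff_continuousAt.2 fun W => ?_
      refine ContinuousAt.comp (g := G)
        (f := fun W : ι → ℝ => fun k => if k ∈ s then -Complex.I else (W k : ℂ))
        (hG _ (him1 W) (him2 W)).continuousAt ?_
      refine continuousAt_pi.2 fun j => ?_
      split_ifs
      · exact continuousAt_const
      · exact (Complex.continuous_ofReal.comp (continuous_apply j)).continuousAt
    have hHi : Integrable H (Measure.pi fun _ => cauchy) :=
      Integrable.of_bound hHc.aestronglyMeasurable M
        (Eventually.of_forall fun W => hM _ (him1 W) (him2 W))
    have hmp := measurePreserving_update_pi_cauchy k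
    have e1 : ∫ W, H W ∂(Measure.pi fun _ => cauchy) =
        ∫ p, H (Function.update p.1 k p.2) ∂((Measure.pi fun _ => cauchy).prod cauchy) := by
      conv_lhs => rw [← hmp.map_eq]
      exact integral_map hmp.measurable.aemeasurable hHc.aestronglyMeasurable
    rw [e1, integral_prod (fun p : (ι → ℝ) × ℝ => H (Function.update p.1 k p.2))
      (hmp.integrable_comp_of_integrable hHi)]
    refine integral_congr_ae (Eventually.of_forall fun W => ?_)
    have hcurve : ∀ z : ℂ, z.im ≤ 0 →
        (∀ j, (if j = k then z else if j ∈ s then -Complex.I else (W j : ℂ)).im ≤ 0) ∧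
        (∀ j, j ∉ S → (if j = k then z else if j ∈ s then -Complex.I else (W j : ℂ)).im = 0) := by
      intro z hz
      refine ⟨fun j => ?_, fun j hj => ?_⟩
      · split_ifs <;> simp [hz]
      · rw [if_neg (fun h => hj (by rw [h]; exact hkS))]; exact him2 W j hj
    have := integral_cauchy_of_lowerHalfPlane (M := M)
      (g := fun z => G (fun j => if j = k then z else if j ∈ s then -Complex.I else (W j : ℂ)))
      (fun z hz => by
        refine DifferentiableAt.comp (g := G) z
          (f := fun z : ℂ => fun j => if j = k then z else if j ∈ s then -Complex.I else (W j : ℂ))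
          (hG _ (hcurve z hz).1 (hcurve z hz).2) ?_
        refine differentiableAt_pi.2 fun j => ?_
        split_ifs <;> fun_prop)
      (fun z hz => hM _ (hcurve z hz).1 (hcurve z hz).2)
    simp only []
    calc ∫ x : ℝ, H (Function.update W k x) ∂cauchy
        = ∫ x : ℝ, G (fun j => if j = k then (x : ℂ) else if j ∈ s then -Complex.I else (W j : ℂ))
          ∂cauchy := by
          refine integral_congr_ae (Eventually.of_forall fun x => ?_)
          simp only [hH]
          congr 1
          ext j
          by_cases hj : j = k
          · subst hj; simp [hk]
          · simp [hj]
      _ = _ := this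
      _ = _ := by
          congr 1
          ext j
          by_cases hj : j = k
          · subst hj; simp
          · simp [hj]

lemma integral_pi_cauchy_pair [Fintype ι] {Φ : ℝ × ℝ → ℂ} (hΦ : Continuous Φ) {i₁ i₂ : ι}
    (h : i₁ ≠ i₂) :
    ∫ W : ι → ℝ, Φ (W i₁, W i₂) ∂(Measure.pi fun _ => cauchy) =
      ∫ p, Φ p ∂(cauchy.prod cauchy) := by
  have hind : ProbabilityTheory.IndepFun (fun W : ι → ℝ => W i₁) (fun W : ι → ℝ => W i₂)
      (Measure.pi fun _ => cauchy) :=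
    (ProbabilityTheory.iIndepFun_pi (μ := fun _ : ι => cauchy) (X := fun _ x => x)
      fun _ => aemeasurable_id).indepFun h
  rw [ProbabilityTheory.indepFun_iff_map_prod_eq_prod_map_map (measurable_pi_apply _).aemeasurable
    (measurable_pi_apply _).aemeasurable] at hind
  have hev : ∀ i : ι, Measure.map (fun W : ι → ℝ => W i) (Measure.pi fun _ => cauchy) = cauchy :=
    fun i => (measurePreserving_eval (fun _ : ι => cauchy) i).map_eq
  rw [hev, hev] at hind
  rw [← hind, integral_map ((measurable_pi_apply i₁).prodMk (measurable_pi_apply i₂)).aemeasurable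
    hΦ.aestronglyMeasurable]

lemma tendsto_integral_path {f : (ι → ℂ) → ℂ} {B κ : ℝ} (hκ : 0 < κ)
    (hf : ∀ V : ι → ℂ, (∀ j, (V j).im < 0) → DifferentiableAt ℂ f V)
    (hB : ∀ V : ι → ℂ, (∀ j, (V j).im ≤ -κ) → ‖f V‖ ≤ B)
    {α : Type*} [TopologicalSpace α] [MeasurableSpace α] [OpensMeasurableSpace α] {μ : Measure α}
    {P : α → ι → ℂ} (hP : Continuous P) (hPim : ∀ p j, (P p j).im ≤ -κ)
    {w : α → ℂ} (hw : Integrable w μ) :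
    Tendsto (fun η : ℝ => ∫ p, f (fun j => P p j - η * Complex.I) * w p ∂μ)
        (nhdsWithin 0 (Set.Ioi 0)) (nhds (∫ p, f (P p) * w p ∂μ)) ∧
      ‖∫ p, f (P p) * w p ∂μ‖ ≤ B * ∫ p, ‖w p‖ ∂μ := by
  constructor
  · refine tendsto_integral_filter_of_dominated_convergence (fun p => B * ‖w p‖) ?_ ?_
      (hw.norm.const_mul B) (Eventually.of_forall fun p => ?_)
    · filter_upwards [self_mem_nhdsWithin] with η hη
      refine AEStronglyMeasurable.mul (Continuous.aestronglyMeasurable ?_) hw.1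
      refine continuous_iff_continuousAt.2 fun p => ?_
      refine ContinuousAt.comp (g := f) (f := fun p => fun j => P p j - η * Complex.I)
        (hf _ fun j => ?_).continuousAt ?_
      · have := hPim p j
        have h0 : (0 : ℝ) < η := hη
        simp; linarith
      · refine continuousAt_pi.2 fun j => ?_
        exact (((continuous_apply j).comp hP).sub continuous_const).continuousAt
    · filter_upwards [self_mem_nhdsWithin] with η hη
      refine Eventually.of_forall fun p => ?_
      rw [norm_mul]
      gcongr
      refine hB _ fun j => ?_
      have := hPim p j
      have h0 : (0 : ℝ) < η := hη
      simp; linarith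
    · refine Tendsto.mul_const _ ?_
      refine Tendsto.mono_left ?_ nhdsWithin_le_nhds
      have hc : ContinuousAt f (P p) := (hf _ fun j => by linarith [hPim p j]).continuousAt
      refine hc.tendsto.comp ?_
      refine tendsto_pi_nhds.2 fun j => ?_
      have : Continuous fun η : ℝ => P p j - η * Complex.I := by fun_prop
      simpa using this.tendsto 0
  · rw [← integral_const_mul]
    refine norm_integral_le_of_norm_le (hw.norm.const_mul B) (Eventually.of_forall fun p => ?_)
    rw [norm_mul]
    gcongr
    exact hB _ (hPim p)

/-- The linear map `w ↦ V` of a single pair correlation of strength `-a` between `i₁` and `i₂`. -/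
def pairMap [DecidableEq ι] (a : ℝ) (i₁ i₂ : ι) (w : ι → ℂ) : ι → ℂ := fun j =>
  if j = i₁ then w i₁ - a * w i₂ else if j = i₂ then w i₂ - a * w i₁ else w j

/-- The vector with entries `u` at `i₁`, `v` at `i₂` and `-i` elsewhere. -/
def pairSlot [DecidableEq ι] (i₁ i₂ : ι) (p : ℂ × ℂ) : ι → ℂ := fun j =>
  if j = i₁ then p.1 else if j = i₂ then p.2 else -Complex.I

lemma continuous_pairSlot [DecidableEq ι] (i₁ i₂ : ι) : Continuous (pairSlot i₁ i₂) := by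
  refine continuous_pi fun j => ?_
  unfold pairSlot
  split_ifs <;> fun_prop

lemma pairSlot_im_le [DecidableEq ι] {i₁ i₂ : ι} {p : ℂ × ℂ} {κ : ℝ} (hκ : κ ≤ 1) (h1 : p.1.im ≤ -κ)
    (h2 : p.2.im ≤ -κ) (j : ι) : (pairSlot i₁ i₂ p j).im ≤ -κ := by
  unfold pairSlot
  split_ifs
  · exact h1
  · exact h2
  · simpa using hκ

/-- Boundary values of the averages of a function holomorphic on the product of lower half-planes,
for i.i.d. Cauchy variables with a single weak negative pair correlation. -/
theorem exists_limit_pairMap [Fintype ι] [DecidableEq ι] {f : (ι → ℂ) → ℂ} {B a : ℝ}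
    {i₁ i₂ : ι} (hne : i₁ ≠ i₂)
    (ha : 0 < a) (ha' : a ≤ 1 / 16)
    (hf : ∀ V : ι → ℂ, (∀ j, (V j).im < 0) → DifferentiableAt ℂ f V)
    (hB : ∀ κ : ℝ, 0 < κ → ∀ V : ι → ℂ, (∀ j, (V j).im ≤ -κ) → ‖f V‖ ≤ B / κ) :
    ∃ limit : ℂ,
      Tendsto (fun η : ℝ => ∫ W : ι → ℝ, f (fun j => pairMap a i₁ i₂ (fun k => W k) j -
          η * Complex.I) ∂(Measure.pi fun _ => cauchy))
        (nhdsWithin 0 (Set.Ioi 0)) (nhds limit) ∧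
      ‖limit - f (pairSlot i₁ i₂ (-Complex.I * (1 - a), -Complex.I * (1 - a)))‖ ≤
        2000 * B * a := by
  set K : ℝ := 1 / (2 * a) with hKdef
  have hK : 2 * a * K = 1 := by rw [hKdef]; field_simp
  have hK8 : 8 ≤ K := by nlinarith
  set P₁ : ℝ → ι → ℂ := fun t => pairSlot i₁ i₂ (-Complex.I - a * (t + (-K : ℝ) * Complex.I),
    t + (-K : ℝ) * Complex.I + a * Complex.I) with hP₁
  set P₂ : ℝ × ℝ → ι → ℂ := fun p => pairSlot i₁ i₂ ((p.1 + (-K : ℝ) * Complex.I) -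
    a * ((p.2 + a * p.1 : ℝ) + (-(3 / 4) : ℝ) * Complex.I), p.2 + (-(1 / 4) : ℝ) * Complex.I)
    with hP₂
  obtain ⟨hw₁, hw₁'⟩ := integral_norm_rho_line_le (K := K) (by linarith)
  obtain ⟨hw₂, hw₂'⟩ := integrable_shearWeight (K := K) (by linarith) a
  obtain ⟨t₁, b₁⟩ := tendsto_integral_path (κ := 1 / 4) (P := P₁) (by norm_num) hf
    (hB _ (by norm_num)) ((continuous_pairSlot i₁ i₂).comp (by fun_prop))
    (fun t j => pairSlot_im_le (by norm_num) (by simp; linarith) (by simp; linarith) j) hw₁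
  obtain ⟨t₂, b₂⟩ := tendsto_integral_path (κ := 1 / 4) (P := P₂) (by norm_num) hf
    (hB _ (by norm_num)) ((continuous_pairSlot i₁ i₂).comp (by fun_prop))
    (fun t j => pairSlot_im_le (by norm_num) (by simp; linarith) (by simp) j) hw₂
  set V₀ : ι → ℂ := pairSlot i₁ i₂ (-Complex.I * (1 - a), -Complex.I * (1 - a)) with hV₀
  have hV₀im : ∀ j, (V₀ j).im ≤ -(1 / 4) :=
    pairSlot_im_le (by norm_num) (by simp; linarith) (by simp; linarith)
  have t₀ : Tendsto (fun η : ℝ => f (fun j => V₀ j - η * Complex.I)) (nhdsWithin 0 (Set.Ioi 0))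
      (nhds (f V₀)) := by
    refine Tendsto.mono_left ?_ nhdsWithin_le_nhds
    have hc : ContinuousAt f V₀ := (hf _ fun j => by linarith [hV₀im j]).continuousAt
    refine hc.tendsto.comp (tendsto_pi_nhds.2 fun j => ?_)
    have : Continuous fun η : ℝ => V₀ j - η * Complex.I := by fun_prop
    simpa using this.tendsto 0
  refine ⟨_, ((t₀.add t₁).add t₂).congr' ?_, ?_⟩
  · filter_upwards [self_mem_nhdsWithin] with η hη
    have hη : (0 : ℝ) < η := hη
    set φ : ℂ × ℂ → ℂ := fun p => f (fun j => pairSlot i₁ i₂ p j - η * Complex.I) with hφdef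
    have hslot : ∀ p : ℂ × ℂ, p.1.im ≤ 0 → p.2.im ≤ 0 → ∀ j,
        (pairSlot i₁ i₂ p j - η * Complex.I).im ≤ -η := by
      intro p h1 h2 j
      have := pairSlot_im_le (i₁ := i₁) (i₂ := i₂) (p := p) (κ := 0) zero_le_one (by simpa)
        (by simpa) j
      simp; linarith
    have hφ : ∀ p : ℂ × ℂ, p.1.im ≤ 0 → p.2.im ≤ 0 → DifferentiableAt ℂ φ p := by
      intro p h1 h2
      refine DifferentiableAt.comp (g := f) p
        (f := fun p : ℂ × ℂ => fun j => pairSlot i₁ i₂ p j - η * Complex.I)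
        (hf _ fun j => by linarith [hslot p h1 h2 j]) ?_
      refine differentiableAt_pi.2 fun j => ?_
      unfold pairSlot
      split_ifs <;> fun_prop
    have hφM : ∀ p : ℂ × ℂ, p.1.im ≤ 0 → p.2.im ≤ 0 → ‖φ p‖ ≤ B / η :=
      fun p h1 h2 => hB η hη _ (hslot p h1 h2)
    have h2d := integral_cauchy_negative_pair ha ha' hK hφ hφM
    set S : Finset ι := Finset.univ.filter fun j => j ≠ i₁ ∧ j ≠ i₂ with hS
    have hpm : ∀ w : ι → ℂ, (∀ k, (w k).im ≤ 0) → (∀ k, k ∉ S → (w k).im = 0) → ∀ j,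
        (pairMap a i₁ i₂ w j - η * Complex.I).im ≤ -η := by
      intro w h1 h2 j
      have e1 := h2 i₁ (by simp [hS])
      have e2 := h2 i₂ (by simp [hS])
      have e3 := h1 j
      unfold pairMap
      split_ifs <;> simp [e1, e2, e3]
    have hrep := integral_pi_cauchy_replace (M := B / η) S
      (G := fun w => f (fun j => pairMap a i₁ i₂ w j - η * Complex.I))
      (fun w h1 h2 => by
        refine DifferentiableAt.comp (g := f) w
          (f := fun w : ι → ℂ => fun j => pairMap a i₁ i₂ w j - η * Complex.I)
          (hf _ fun j => by linarith [hpm w h1 h2 j]) ?_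
        refine differentiableAt_pi.2 fun j => ?_
        unfold pairMap
        split_ifs <;> fun_prop)
      (fun w h1 h2 => hB η hη _ (hpm w h1 h2))
    set Φ : ℝ × ℝ → ℂ := fun p => φ ((p.1 - a * p.2 : ℝ), (p.2 - a * p.1 : ℝ)) with hΦ
    have hΦc : Continuous Φ := by
      refine continuous_iff_continuousAt.2 fun p => ?_
      exact ContinuousAt.comp (g := φ)
        (f := fun p : ℝ × ℝ => (((p.1 - a * p.2 : ℝ) : ℂ), ((p.2 - a * p.1 : ℝ) : ℂ)))
        (hφ _ (by simp) (by simp)).continuousAt (by fun_prop)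
    have hΦi : Integrable Φ (cauchy.prod cauchy) :=
      Integrable.of_bound hΦc.aestronglyMeasurable (B / η)
        (Eventually.of_forall fun p => hφM _ (by simp) (by simp))
    have hpair := integral_pi_cauchy_pair hΦc hne
    rw [integral_prod _ hΦi] at hpair
    rw [hrep]
    symm
    calc _ = ∫ W : ι → ℝ, Φ (W i₁, W i₂) ∂(Measure.pi fun _ => cauchy) := by
          refine integral_congr_ae (Eventually.of_forall fun W => ?_)
          simp only [hΦ, hφdef]
          congr 1
          ext j
          congr 1
          unfold pairMap pairSlot
          have m1 : i₁ ∉ S := by simp [hS]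
          have m2 : i₂ ∉ S := by simp [hS]
          by_cases j1 : j = i₁
          · simp [j1, m1, m2]
          · by_cases j2 : j = i₂
            · simp [j2, hne.symm, m1, m2]
            · simp [j1, j2, hS]
      _ = _ := hpair
      _ = _ := h2d
  · have hB0 : 0 ≤ B := by
      have := (norm_nonneg _).trans (hB 1 one_pos (fun _ => -Complex.I) (by simp))
      simpa using this
    have e : ∀ x y z : ℂ, x + y + z - x = y + z := fun x y z => by ring
    rw [e]
    have hpi := Real.pi_pos
    have hpi4 := Real.pi_le_four
    have hKinv : 2 * Real.pi / K = 4 * Real.pi * a := by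
      rw [hKdef]; field_simp; ring
    rw [hKinv] at hw₁' hw₂'
    have c₁ := b₁.trans (mul_le_mul_of_nonneg_left hw₁' (by positivity))
    have c₂ := b₂.trans (mul_le_mul_of_nonneg_left hw₂' (by positivity))
    have hBa : 0 ≤ B * a := by positivity
    have hpi2 : Real.pi ^ 2 ≤ 16 := by nlinarith
    calc _ ≤ _ := norm_add_le _ _
      _ ≤ _ := add_le_add c₁ c₂
      _ = 16 * (B * a) * Real.pi + 64 * (B * a) * Real.pi ^ 2 := by ring
      _ ≤ 16 * (B * a) * 4 + 64 * (B * a) * 16 := by gcongr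
      _ ≤ 2000 * B * a := by nlinarith

end ProductMeasure

section Dissipative

variable {ι : Type*} [Fintype ι] [DecidableEq ι]

/-- If `A` has Hermitian real part, then `Im ⟨ψ, Aψ⟩` only sees the diagonal imaginary part. -/
lemma im_star_dotProduct_mulVec {B : Matrix ι ι ℂ} (hB : B.IsHermitian) (D : ι → ℝ) (ψ : ι → ℂ) :
    (star ψ ⬝ᵥ (B + Complex.I • diagonal fun k => (D k : ℂ)) *ᵥ ψ).im = ∑ k, D k * ‖ψ k‖ ^ 2 := by
  have h1 : (star ψ ⬝ᵥ B *ᵥ ψ).im = 0 := hB.im_star_dotProduct_mulVec_self ψ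
  rw [add_mulVec, dotProduct_add, Complex.add_im, h1, zero_add, smul_mulVec, dotProduct_smul]
  simp only [dotProduct, mulVec_diagonal, smul_eq_mul, Finset.mul_sum, Complex.im_sum]
  refine Finset.sum_congr rfl fun k _ => ?_
  have : Complex.I * (star ψ k * ((D k : ℂ) * ψ k)) =
      Complex.I * ((D k * ‖ψ k‖ ^ 2 : ℝ) : ℂ) := by
    have := Complex.conj_mul' (ψ k)
    simp only [Pi.star_apply, RCLike.star_def]
    push_cast
    rw [← this]; ring
  rw [this, Complex.I_mul_im, Complex.ofReal_re]

lemma isUnit_det_of_dissipative {B : Matrix ι ι ℂ} (hB : B.IsHermitian) {D : ι → ℝ}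
    (hD : ∀ k, 0 < D k) : IsUnit (B + Complex.I • diagonal fun k => (D k : ℂ)).det := by
  rw [isUnit_iff_ne_zero]
  intro h0
  obtain ⟨v, hv, hv0⟩ := exists_mulVec_eq_zero_iff.2 h0
  have h := im_star_dotProduct_mulVec hB D v
  rw [hv0, dotProduct_zero, Complex.zero_im] at h
  refine hv (funext fun k => ?_)
  have := (Finset.sum_eq_zero_iff_of_nonneg fun k _ =>
    mul_nonneg (hD k).le (sq_nonneg ‖v k‖)).1 h.symm k (Finset.mem_univ k)
  simpa [(hD k).ne'] using this

lemma mulVec_inv_col {A : Matrix ι ι ℂ} (hA : IsUnit A.det) (j : ι) :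
    A *ᵥ (A⁻¹).col j = Pi.single j 1 := by
  rw [← mulVec_single_one, mulVec_mulVec, mul_nonsing_inv _ hA, one_mulVec]

lemma sum_mul_norm_sq_inv_col {B : Matrix ι ι ℂ} (hB : B.IsHermitian) {D : ι → ℝ}
    (hD : ∀ k, 0 < D k) (j : ι) :
    ∑ k, D k * ‖(B + Complex.I • diagonal fun k => (D k : ℂ))⁻¹ k j‖ ^ 2 =
      -((B + Complex.I • diagonal fun k => (D k : ℂ))⁻¹ j j).im := by
  have h := im_star_dotProduct_mulVec hB D
    ((B + Complex.I • diagonal fun k => (D k : ℂ))⁻¹.col j)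
  rw [mulVec_inv_col (isUnit_det_of_dissipative hB hD) j] at h
  simp only [col_apply] at h
  rw [← h]
  simp

lemma norm_inv_diag_le {B : Matrix ι ι ℂ} (hB : B.IsHermitian) {D : ι → ℝ} {κ : ℝ} (hκ : 0 < κ)
    (hD : ∀ k, κ ≤ D k) (j : ι) :
    ‖(B + Complex.I • diagonal fun k => (D k : ℂ))⁻¹ j j‖ ≤ 1 / κ := by
  have h := sum_mul_norm_sq_inv_col hB (fun k => hκ.trans_le (hD k)) j
  set r := (B + Complex.I • diagonal fun k => (D k : ℂ))⁻¹ with hr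
  have h1 : κ * ‖r j j‖ ^ 2 ≤ ∑ k, D k * ‖r k j‖ ^ 2 :=
    (mul_le_mul_of_nonneg_right (hD j) (sq_nonneg _)).trans
      (Finset.single_le_sum (f := fun k => D k * ‖r k j‖ ^ 2)
        (fun k _ => mul_nonneg (hκ.le.trans (hD k)) (sq_nonneg _)) (Finset.mem_univ j))
  have h2 : -(r j j).im ≤ ‖r j j‖ := (neg_le_abs _).trans (Complex.abs_im_le_norm _)
  rw [le_div_iff₀ hκ]
  rcases (norm_nonneg (r j j)).eq_or_lt with h0 | h0
  · rw [← h0]; simp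
  · nlinarith

lemma norm_trace_inv_le {B : Matrix ι ι ℂ} (hB : B.IsHermitian) {D : ι → ℝ} {κ : ℝ} (hκ : 0 < κ)
    (hD : ∀ k, κ ≤ D k) :
    ‖trace (B + Complex.I • diagonal fun k => (D k : ℂ))⁻¹‖ ≤ Fintype.card ι / κ := by
  refine (norm_sum_le_of_le _ fun j _ => norm_inv_diag_le hB hκ hD j).trans_eq ?_
  simp [div_eq_mul_inv]

/-- Lower bound on the trace of the resolvent of a matrix whose rows have bounded `ℓ²` norm. -/
lemma le_norm_trace_inv {B : Matrix ι ι ℂ} (hB : B.IsHermitian) {D : ι → ℝ} {κ M : ℝ} (hκ : 0 < κ)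
    (hM : 0 < M) (hD : ∀ k, κ ≤ D k)
    (hrow : ∀ j, ∑ k, ‖(B + Complex.I • diagonal fun k => (D k : ℂ)) j k‖ ^ 2 ≤ M) :
    Fintype.card ι * (κ / M) ≤ ‖trace (B + Complex.I • diagonal fun k => (D k : ℂ))⁻¹‖ := by
  have hD' : ∀ k, 0 < D k := fun k => hκ.trans_le (hD k)
  have hcol := sum_mul_norm_sq_inv_col hB hD'
  have hinv := fun j => congrFun (mulVec_inv_col (isUnit_det_of_dissipative hB hD') j) j
  set A := B + Complex.I • diagonal fun k => (D k : ℂ) with hA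
  have hdiag : ∀ j, κ / M ≤ -(A⁻¹ j j).im := by
    intro j
    have h1 : (1 : ℝ) ≤ ∑ k, ‖A j k‖ * ‖A⁻¹ k j‖ := by
      have := hinv j
      simp only [mulVec, dotProduct, col_apply, Pi.single_eq_same] at this
      calc (1 : ℝ) = ‖∑ k, A j k * A⁻¹ k j‖ := by rw [this]; simp
        _ ≤ _ := norm_sum_le_of_le _ fun k _ => (norm_mul _ _).le
    have h2 := Finset.sum_mul_sq_le_sq_mul_sq Finset.univ (fun k => ‖A j k‖) (fun k => ‖A⁻¹ k j‖)
    have h3 : κ * ∑ k, ‖A⁻¹ k j‖ ^ 2 ≤ -(A⁻¹ j j).im := by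
      rw [← hcol j, Finset.mul_sum]
      exact Finset.sum_le_sum fun k _ => mul_le_mul_of_nonneg_right (hD k) (sq_nonneg _)
    have h4 : 0 ≤ ∑ k, ‖A⁻¹ k j‖ ^ 2 := Finset.sum_nonneg fun k _ => sq_nonneg _
    have h5 : (1 : ℝ) ≤ M * ∑ k, ‖A⁻¹ k j‖ ^ 2 :=
      calc (1 : ℝ) ≤ (∑ k, ‖A j k‖ * ‖A⁻¹ k j‖) ^ 2 := one_le_pow₀ h1
        _ ≤ _ := h2
        _ ≤ _ := mul_le_mul_of_nonneg_right (hrow j) h4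
    rw [div_le_iff₀ hM]
    nlinarith
  calc Fintype.card ι * (κ / M) = ∑ _j : ι, κ / M := by simp
    _ ≤ ∑ j, -(A⁻¹ j j).im := Finset.sum_le_sum fun j _ => hdiag j
    _ = -(trace A⁻¹).im := by simp [trace, Complex.im_sum]
    _ ≤ _ := (neg_le_abs _).trans (Complex.abs_im_le_norm _)

lemma differentiableAt_trace_inv {F : Type*} [NormedAddCommGroup F] [NormedSpace ℂ F]
    {A : F → Matrix ι ι ℂ} {x : F} (hA : ∀ j k, DifferentiableAt ℂ (fun y => A y j k) x)
    (hx : IsUnit (A x).det) : DifferentiableAt ℂ (fun y => trace (A y)⁻¹) x := by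
  have hdet : ∀ C : F → Matrix ι ι ℂ, (∀ j k, DifferentiableAt ℂ (fun y => C y j k) x) →
      DifferentiableAt ℂ (fun y => (C y).det) x := by
    intro C hC
    simp only [det_apply]
    refine DifferentiableAt.fun_sum fun σ _ => ?_
    simp only [Units.smul_def, zsmul_eq_mul]
    refine (differentiableAt_const _).mul ?_
    exact (HasFDerivAt.finsetProd fun k _ => (hC (σ k) k).hasFDerivAt).differentiableAt
  have h : (fun y => trace (A y)⁻¹) = fun y => (A y).det⁻¹ * ∑ j, (A y).adjugate j j := by
    ext y
    rw [inv_def, trace_smul, Ring.inverse_eq_inv', smul_eq_mul]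
    rfl
  rw [h]
  refine ((hdet A hA).inv hx.ne_zero).mul (DifferentiableAt.fun_sum fun j _ => ?_)
  simp only [adjugate_apply]
  refine hdet _ fun k l => ?_
  by_cases hk : k = j
  · subst hk; simp
  · simpa [updateRow_ne hk] using hA k l

end Dissipative

section Laplacian

variable {d : ℕ}

lemma dist1_comm (x y : Fin d → ℤ) : dist1 x y = dist1 y x := by
  simp only [dist1, abs_sub_comm]

lemma dist1_self (x : Fin d → ℤ) : dist1 x x = 0 := by
  simp [dist1]

lemma isHermitian_lap (Λ : Finset (Fin d → ℤ)) : (lap Λ).IsHermitian := by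
  ext j k
  simp only [conjTranspose_apply, lap, lapE, dist1_comm (k : Fin d → ℤ) (j : Fin d → ℤ)]
  by_cases h : (k : Fin d → ℤ) = j
  · rw [if_pos h, if_pos h.symm, h]
    split_ifs <;> simp
  · rw [if_neg h, if_neg (Ne.symm h)]
    split_ifs <;> simp

lemma card_neighbours_le (Λ : Finset (Fin d → ℤ)) (j : Fin d → ℤ) :
    (Λ.filter fun k => dist1 j k = 1).card ≤ 3 ^ d := by
  have hsub : (Λ.filter fun k => dist1 j k = 1) ⊆ Finset.Icc (j - 1) (j + 1) := by
    intro k hk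
    have h := (Finset.mem_filter.1 hk).2
    have hi : ∀ i, |j i - k i| ≤ 1 := fun i => by
      rw [← h]
      exact Finset.single_le_sum (f := fun i => |j i - k i|) (fun _ _ => abs_nonneg _)
        (Finset.mem_univ i)
    refine Finset.mem_Icc.2 ⟨fun i => ?_, fun i => ?_⟩
    · have := abs_le.1 (hi i)
      simp; omega
    · have := abs_le.1 (hi i)
      simp; omega
  refine (Finset.card_le_card hsub).trans_eq ?_
  rw [Pi.card_Icc]
  have : ∀ i, (Finset.Icc ((j - 1) i) ((j + 1) i)).card = 3 := fun i => by
    simp; omega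
  rw [Finset.prod_congr rfl fun i _ => this i]
  simp

/-- Row bound for `E + Δ + i D` with a bounded real diagonal `D`. -/
lemma sum_norm_sq_row_le (Λ : Finset (Fin d → ℤ)) (E lam : ℝ) {D : Λ → ℝ}
    (hD : ∀ k, |D k| ≤ lam) (j : Λ) :
    ∑ k, ‖((E : ℂ) • (1 : Matrix Λ Λ ℂ) + lap Λ + Complex.I • diagonal fun k => (D k : ℂ)) j k‖ ^ 2
      ≤ (|E| + 2 * 3 ^ d + lam) ^ 2 := by
  set N := (Λ.filter fun k => dist1 (j : Fin d → ℤ) k = 1).card with hN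
  have hN3 : (N : ℝ) ≤ 3 ^ d := by exact_mod_cast card_neighbours_le Λ j
  have hlam : 0 ≤ lam := (abs_nonneg _).trans (hD j)
  have hentry : ∀ k : Λ,
      ‖((E : ℂ) • (1 : Matrix Λ Λ ℂ) + lap Λ + Complex.I • diagonal fun k => (D k : ℂ)) j k‖ ^ 2 ≤
        (if k = j then (|E| + N + lam) ^ 2 else 0) +
          if dist1 (j : Fin d → ℤ) k = 1 then 1 else 0 := by
    intro k
    by_cases hk : k = j
    · subst hk
      have : ((E : ℂ) • (1 : Matrix Λ Λ ℂ) + lap Λ + Complex.I • diagonal fun k => (D k : ℂ)) k k =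
          E - N + Complex.I * D k := by
        simp [lap, lapE, dist1_self, hN]; ring
      rw [this, if_pos rfl, dist1_self]
      have h1 : ‖(E : ℂ) - N + Complex.I * D k‖ ≤ |E| + N + lam :=
        calc _ ≤ ‖(E : ℂ)‖ + ‖(N : ℂ)‖ + ‖Complex.I * D k‖ :=
              (norm_add_le _ _).trans (by gcongr; exact norm_sub_le _ _)
          _ ≤ _ := by
            simp only [norm_mul, Complex.norm_I, one_mul, Complex.norm_real, Real.norm_eq_abs,
              Complex.norm_natCast]
            gcongr
            exact hD k
      have := pow_le_pow_left₀ (norm_nonneg _) h1 2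
      simpa using this
    · have hk' : (j : Fin d → ℤ) ≠ k := fun h => hk (Subtype.ext h.symm)
      have : ((E : ℂ) • (1 : Matrix Λ Λ ℂ) + lap Λ + Complex.I • diagonal fun k => (D k : ℂ)) j k =
          if dist1 (j : Fin d → ℤ) k = 1 then 1 else 0 := by
        simp [lap, lapE, hk', one_apply, Ne.symm hk]
      rw [this, if_neg hk]
      split_ifs <;> simp
  have hcount : ∑ k : Λ, (if dist1 (j : Fin d → ℤ) k = 1 then (1 : ℝ) else 0) = N := by
    rw [Finset.sum_coe_sort Λ (fun k => if dist1 (j : Fin d → ℤ) k = 1 then (1 : ℝ) else 0)]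
    simp [hN]
  calc _ ≤ ∑ k : Λ, ((if k = j then (|E| + N + lam) ^ 2 else 0) +
          if dist1 (j : Fin d → ℤ) k = 1 then 1 else 0) := Finset.sum_le_sum fun k _ => hentry k
    _ = (|E| + N + lam) ^ 2 + N := by rw [Finset.sum_add_distrib, hcount]; simp
    _ ≤ (|E| + 3 ^ d + lam) ^ 2 + 3 ^ d := by gcongr
    _ ≤ (|E| + 2 * 3 ^ d + lam) ^ 2 := by
      have h3 : (1 : ℝ) ≤ 3 ^ d := one_le_pow₀ (by norm_num)
      have := abs_nonneg E
      nlinarith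

end Laplacian

section Toymodel

variable {d : ℕ}

lemma isHermitian_smul_one_add {ι : Type*} [Fintype ι] [DecidableEq ι] {B : Matrix ι ι ℂ}
    (hB : B.IsHermitian) (E : ℝ) (v : ι → ℝ) :
    ((E : ℂ) • (1 : Matrix ι ι ℂ) + B - diagonal fun j => (v j : ℂ)).IsHermitian := by
  refine ((IsHermitian.ext fun j k => ?_).add hB).sub (IsHermitian.ext fun j k => ?_)
  · by_cases h : j = k
    · simp [h]
    · simp [one_apply, h, Ne.symm h]
  · by_cases h : j = k
    · simp [h]
    · simp [h, Ne.symm h]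

lemma sub_diagonal_eq_re_add_im {ι : Type*} [DecidableEq ι] (A : Matrix ι ι ℂ) (lam : ℝ)
    (V : ι → ℂ) :
    A - diagonal (fun j => (lam : ℂ) * V j) = A - diagonal (fun j => ((lam * (V j).re : ℝ) : ℂ)) +
      Complex.I • diagonal fun j => ((-(lam * (V j).im) : ℝ) : ℂ) := by
  rw [← diagonal_smul, sub_add, diagonal_sub]
  congr 2
  ext j
  apply Complex.ext <;> simp

lemma differentiableAt_trace_resolvent (Λ : Finset (Fin d → ℤ)) (E : ℝ) {lam : ℝ} (hlam : 0 < lam)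
    {V : Λ → ℂ} (hV : ∀ j, (V j).im < 0) :
    DifferentiableAt ℂ (fun V : Λ → ℂ => trace
      ((E : ℂ) • (1 : Matrix Λ Λ ℂ) + lap Λ - diagonal fun j => (lam : ℂ) * V j)⁻¹) V := by
  refine differentiableAt_trace_inv (fun j k => ?_) ?_
  · by_cases h : j = k
    · subst h
      simp only [Matrix.sub_apply, diagonal_apply_eq]
      fun_prop
    · simp only [Matrix.sub_apply, diagonal_apply_ne _ h]
      fun_prop
  · rw [sub_diagonal_eq_re_add_im]
    exact isUnit_det_of_dissipative (isHermitian_smul_one_add (isHermitian_lap Λ) E _)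
      fun k => by nlinarith [hV k]

lemma norm_trace_resolvent_le (Λ : Finset (Fin d → ℤ)) (E : ℝ) {lam κ : ℝ} (hlam : 0 < lam)
    (hκ : 0 < κ) {V : Λ → ℂ} (hV : ∀ j, (V j).im ≤ -κ) :
    ‖trace ((E : ℂ) • (1 : Matrix Λ Λ ℂ) + lap Λ - diagonal fun j => (lam : ℂ) * V j)⁻¹‖ ≤
      Λ.card / lam / κ := by
  rw [sub_diagonal_eq_re_add_im, div_div]
  refine (norm_trace_inv_le (isHermitian_smul_one_add (isHermitian_lap Λ) E _) (mul_pos hlam hκ)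
    fun k => ?_).trans_eq (by simp)
  nlinarith [hV k]

/-- The effective non-Hermitian resolvent with dissipation between `λ/2` and `λ`. -/
lemma le_norm_trace_effective (Λ : Finset (Fin d → ℤ)) (E : ℝ) {lam : ℝ} (hlam : 0 < lam)
    {t : Λ → ℝ} (ht : ∀ j, 1 / 2 ≤ t j) (ht' : ∀ j, t j ≤ 1) :
    Λ.card * (lam / 2 / (|E| + 2 * 3 ^ d + lam) ^ 2) ≤
      ‖trace ((E : ℂ) • (1 : Matrix Λ Λ ℂ) + lap Λ +
        Complex.I • diagonal fun k => ((lam * t k : ℝ) : ℂ))⁻¹‖ := by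
  have hB : ((E : ℂ) • (1 : Matrix Λ Λ ℂ) + lap Λ).IsHermitian := by
    simpa using isHermitian_smul_one_add (isHermitian_lap Λ) E fun _ => 0
  have := le_norm_trace_inv (κ := lam / 2) hB (by positivity)
    (by positivity : 0 < (|E| + 2 * 3 ^ d + lam) ^ 2)
    (D := fun k => lam * t k) (fun k => by nlinarith [ht k])
    (sum_norm_sq_row_le Λ E lam fun k => by
      rw [abs_of_nonneg (mul_nonneg hlam.le (by linarith [ht k]))]
      nlinarith [ht' k])
  simpa using this

lemma sum_toyT_mul {Λ : Finset (Fin d → ℤ)} {i₁ i₂ : Λ} (hne : i₁ ≠ i₂) (δ : ℝ) (w : Λ → ℝ)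
    (j : Λ) : ∑ k, toyT Λ i₁ i₂ δ j k * w k =
      if j = i₁ then w i₁ - δ ^ 2 * w i₂ else if j = i₂ then w i₂ - δ ^ 2 * w i₁ else w j := by
  have hT : ∀ k : Λ, toyT Λ i₁ i₂ δ j k * w k = (if k = j then w j else 0) +
      ((if k = i₂ then (if j = i₁ then -δ ^ 2 * w i₂ else 0) else 0) +
        if k = i₁ then (if j = i₂ then -δ ^ 2 * w i₁ else 0) else 0) := by
    intro k
    simp only [toyT, SetLike.coe_eq_coe]
    by_cases h1 : j = k
    · subst h1
      by_cases h2 : j = i₁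
      · subst h2; simp [hne]
      · simp [h2]
    · by_cases h2 : j = i₁
      · subst h2
        by_cases h3 : k = i₂
        · subst h3; simp [hne, hne.symm]
        · simp [h1, h3, Ne.symm h1, hne]
      · by_cases h3 : j = i₂
        · subst h3
          by_cases h4 : k = i₁
          · subst h4; simp [hne, hne.symm]
          · simp [h1, h4, Ne.symm h1, hne.symm]
        · simp [h1, h2, h3, Ne.symm h1]
  simp only [hT, Finset.sum_add_distrib, Finset.sum_ite_eq', Finset.mem_univ, if_true]
  by_cases h1 : j = i₁
  · subst h1; simp [hne]; ring
  · by_cases h2 : j = i₂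
    · subst h2; simp [hne.symm]; ring
    · simp [h1, h2]

end Toymodel

/-- Theorem 2.7, toymodel with a single negative correlation.
For the Lloyd model with correlation `toyT` (a single negative correlation `-δ²` between
two nearest-neighbour sites `i₁, i₂`), there are constants `c, C₁, C₂ > 0` depending only
on `d` and `E` such that for all `λ > 0`, all `0 < δ < c(1+λ⁻¹)⁻¹` and every cube `Λ`
containing `i₁, i₂`, the limit `lim_{ε→0⁺} 𝔼[Tr((E+iε)1 - H_Λ)⁻¹]` exists and differs
from `Tr(E·1 + iλT̂ - H₀)⁻¹` by at most
`|Tr(E·1 + iλT̂ - H₀)⁻¹| · (C₁ (δ(1+λ⁻¹))² + C₂ |Λ|⁻¹)`. -/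
theorem toymodel_density_of_states (d : ℕ) (hd : 1 ≤ d) (E : ℝ) :
    ∃ c C₁ C₂ : ℝ, 0 < c ∧ 0 < C₁ ∧ 0 < C₂ ∧
      ∀ (i₁ i₂ : Fin d → ℤ), dist1 i₁ i₂ = 1 →
      ∀ (lam : ℝ), 0 < lam →
      ∀ (δ : ℝ), 0 < δ → δ < c * (1 + lam⁻¹)⁻¹ →
      ∀ (L : ℕ), i₁ ∈ cube d L → i₂ ∈ cube d L →
      ∃ limit : ℂ,
        Tendsto
          (fun ε : ℝ =>
            ∫ W : ↥(cube d L) → ℝ,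
              Matrix.trace
                (((((E : ℂ) + ε * Complex.I) • (1 : Matrix (cube d L) (cube d L) ℂ)) -
                  (-(lap (cube d L)) +
                    Matrix.diagonal (fun j =>
                      (lam : ℂ) * ((∑ k, toyT (cube d L) i₁ i₂ δ j k * W k : ℝ) : ℂ))))⁻¹)
              ∂(Measure.pi fun _ => cauchy))
          (nhdsWithin 0 (Set.Ioi 0)) (nhds limit) ∧
        norm (limit -
            Matrix.trace
              (((E : ℂ) • (1 : Matrix (cube d L) (cube d L) ℂ) +
                (Complex.I * lam) •
                  Matrix.diagonal (fun j => ((∑ k, toyT (cube d L) i₁ i₂ δ j k : ℝ) : ℂ)) -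
                (-(lap (cube d L))))⁻¹)) ≤
          norm
            (Matrix.trace
              (((E : ℂ) • (1 : Matrix (cube d L) (cube d L) ℂ) +
                (Complex.I * lam) •
                  Matrix.diagonal (fun j => ((∑ k, toyT (cube d L) i₁ i₂ δ j k : ℝ) : ℂ)) -
                (-(lap (cube d L))))⁻¹)) *
            (C₁ * (δ * (1 + lam⁻¹)) ^ 2 + C₂ * (((cube d L).card : ℝ))⁻¹) := by
  set K : ℝ := |E| + 2 * 3 ^ d with hK
  have hK1 : 1 ≤ K := by
    have h3 : (1 : ℝ) ≤ 3 ^ d := one_le_pow₀ (by norm_num)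
    linarith [abs_nonneg E]
  refine ⟨1 / 4, 4000 * K ^ 2, 1, by norm_num, by positivity, one_pos, ?_⟩
  intro i₁ i₂ hdist lam hlam δ hδ hδc L h₁ h₂
  set Λ := cube d L with hΛ
  have hne : (⟨i₁, h₁⟩ : Λ) ≠ ⟨i₂, h₂⟩ := by
    intro h
    rw [show i₁ = i₂ from congrArg Subtype.val h, dist1_self] at hdist
    exact zero_ne_one hdist
  have hδ4 : δ ≤ 1 / 4 := by
    refine hδc.le.trans (mul_le_of_le_one_right (by norm_num) (inv_le_one_of_one_le₀ ?_))
    linarith [inv_pos.2 hlam]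
  have ha : δ ^ 2 ≤ 1 / 16 := by nlinarith
  have ha0 : 0 < δ ^ 2 := by positivity
  set f : (Λ → ℂ) → ℂ := fun V =>
    trace ((E : ℂ) • (1 : Matrix Λ Λ ℂ) + lap Λ - diagonal fun j => (lam : ℂ) * V j)⁻¹ with hf
  obtain ⟨limit, hlim, hbound⟩ := exists_limit_pairMap (f := f) (B := Λ.card / lam) hne ha0 ha
    (fun V hV => differentiableAt_trace_resolvent Λ E hlam hV)
    (fun κ hκ V hV => norm_trace_resolvent_le Λ E hlam hκ hV)
  set t : Λ → ℝ := fun j => ∑ k, toyT Λ i₁ i₂ δ j k with ht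
  have htj : ∀ j, t j = if j = ⟨i₁, h₁⟩ ∨ j = ⟨i₂, h₂⟩ then 1 - δ ^ 2 else 1 := by
    intro j
    have := sum_toyT_mul hne δ (fun _ => 1) j
    simp only [mul_one] at this
    rw [ht]
    refine this.trans ?_
    by_cases j1 : j = ⟨i₁, h₁⟩
    · simp [j1]
    · by_cases j2 : j = ⟨i₂, h₂⟩
      · simp [j2, hne.symm]
      · simp [j1, j2]
  have heff : (E : ℂ) • (1 : Matrix Λ Λ ℂ) + (Complex.I * lam) • diagonal (fun j => (t j : ℂ)) -
      -lap Λ = (E : ℂ) • (1 : Matrix Λ Λ ℂ) + lap Λ +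
        Complex.I • diagonal fun j => ((lam * t j : ℝ) : ℂ) := by
    rw [sub_neg_eq_add, add_right_comm, mul_smul, ← diagonal_smul]
    congr 3
    ext j
    simp
  have hfeff : f (pairSlot ⟨i₁, h₁⟩ ⟨i₂, h₂⟩ (-Complex.I * (1 - (δ ^ 2 : ℝ)),
      -Complex.I * (1 - (δ ^ 2 : ℝ)))) = trace ((E : ℂ) • (1 : Matrix Λ Λ ℂ) + lap Λ +
        Complex.I • diagonal fun j => ((lam * t j : ℝ) : ℂ))⁻¹ := by
    have : pairSlot (⟨i₁, h₁⟩ : Λ) ⟨i₂, h₂⟩ (-Complex.I * (1 - (δ ^ 2 : ℝ)),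
        -Complex.I * (1 - (δ ^ 2 : ℝ))) = fun j => -Complex.I * t j := by
      ext j
      rw [htj, pairSlot]
      by_cases j1 : j = ⟨i₁, h₁⟩
      · simp [j1]
      · by_cases j2 : j = ⟨i₂, h₂⟩
        · simp [j2, hne.symm]
        · simp [j1, j2]
    rw [this, hf]
    simp only []
    rw [sub_eq_add_neg, diagonal_neg, ← diagonal_smul]
    congr 4
    ext j
    simp
    ring
  refine ⟨limit, ?_, ?_⟩
  · have hη : Tendsto (fun ε : ℝ => ε / lam) (nhdsWithin 0 (Set.Ioi 0))
        (nhdsWithin 0 (Set.Ioi 0)) := by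
      refine tendsto_nhdsWithin_iff.2 ⟨Tendsto.mono_left ?_ nhdsWithin_le_nhds, ?_⟩
      · simpa using (continuous_id.div_const lam).tendsto 0
      · filter_upwards [self_mem_nhdsWithin] with ε hε
        exact div_pos hε hlam
    refine (hlim.comp hη).congr fun ε => ?_
    simp only [Function.comp_apply, hf]
    refine integral_congr_ae (Eventually.of_forall fun W => ?_)
    simp only []
    congr 2
    have hV : ∀ j, (((∑ k, toyT Λ i₁ i₂ δ j k * W k : ℝ)) : ℂ) =
        pairMap (δ ^ 2) ⟨i₁, h₁⟩ ⟨i₂, h₂⟩ (fun k => (W k : ℂ)) j := by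
      intro j
      rw [sum_toyT_mul hne δ W j, pairMap]
      split_ifs <;> push_cast <;> rfl
    simp only [hV]
    rw [add_smul, neg_add_eq_sub, sub_sub_eq_add_sub, 
      smul_one_eq_diagonal ((ε : ℂ) * Complex.I)]
    have hl : (lam : ℂ) ≠ 0 := by exact_mod_cast hlam.ne'
    have hd' : (diagonal fun j => (lam : ℂ) * (pairMap (δ ^ 2) (⟨i₁, h₁⟩ : Λ) ⟨i₂, h₂⟩
        (fun k => (W k : ℂ)) j - ((ε / lam : ℝ) : ℂ) * Complex.I)) =
        (diagonal fun j => (lam : ℂ) * pairMap (δ ^ 2) (⟨i₁, h₁⟩ : Λ) ⟨i₂, h₂⟩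
        (fun k => (W k : ℂ)) j) - diagonal fun _ => (ε : ℂ) * Complex.I := by
      rw [diagonal_sub]
      congr 1
      ext j
      push_cast
      field_simp
    rw [hd']
    abel
  · rw [heff]
    rw [hfeff] at hbound
    have hlow := le_norm_trace_effective Λ E hlam (t := t)
      (fun j => by rw [htj]; split_ifs <;> linarith) (fun j => by rw [htj]; split_ifs <;> linarith)
    rw [← hK] at hlow
    set X := ‖trace ((E : ℂ) • (1 : Matrix Λ Λ ℂ) + lap Λ +
        Complex.I • diagonal fun j => ((lam * t j : ℝ) : ℂ))⁻¹‖ with hX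
    have hX0 : 0 ≤ X := norm_nonneg _
    have hKlam : K + lam ≤ K * (1 + lam) := by nlinarith
    have hscale : (δ * (1 + lam⁻¹)) ^ 2 = δ ^ 2 * (1 + lam) ^ 2 / lam ^ 2 := by
      field_simp
      ring
    calc _ ≤ 2000 * (Λ.card / lam) * δ ^ 2 := hbound
      _ = Λ.card * (lam / 2 / (K * (1 + lam)) ^ 2) *
          (4000 * K ^ 2 * (δ * (1 + lam⁻¹)) ^ 2) := by
        rw [hscale]
        field_simp
        ring
      _ ≤ Λ.card * (lam / 2 / (K + lam) ^ 2) * (4000 * K ^ 2 * (δ * (1 + lam⁻¹)) ^ 2) := by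
        gcongr
      _ ≤ X * (4000 * K ^ 2 * (δ * (1 + lam⁻¹)) ^ 2) := by gcongr
      _ ≤ _ := by
        refine mul_le_mul_of_nonneg_left ?_ hX0
        have : (0 : ℝ) ≤ 1 * (Λ.card : ℝ)⁻¹ := by positivity
        linarith
end
end

section
/- 2×2 determinant-difference estimate from the toymodel error analysis: for every K > 0 there exists C > 0 such that the following holds for all λ > 0 and 0 < δ ≤ 1/2. Let S ∈ ℂ^{2×2} satisfy Re ⟨u, Su⟩ ≥ (λ/2)‖u‖² for all u ∈ ℂ² and |S_{jk}| ≤ K(λ + 1/λ) for all j,k; let X = 2λ·diag(−1, δ²), and let v = (δw, 1)ᵗ with w ∈ ℂ, |w| ≤ 1. Then ⟨v, Xv⟩ = 2λδ²(1−|w|²) ≥ 0, both ⟨v, Sv⟩ and ⟨v, (S+X)v⟩ have real part ≥ (λ/2)‖v‖² > 0, and | det(S+X)/⟨v,(S+X)v⟩² − det S/⟨v,Sv⟩² | ≤ C (1 + λ^{−2}) ( 1 + δ² (1 + λ^{−2}) ). -/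
open Matrix

noncomputable section

lemma norm_div_sq_sub_div_sq_le {A D N P : ℂ} {r : ℝ} (hr : 0 < r) (hN : r ≤ ‖N‖)
    (hP : r ≤ ‖P‖) :
    ‖A / P ^ 2 - D / N ^ 2‖ ≤ ‖A - D‖ / r ^ 2 + 2 * ‖D‖ * ‖P - N‖ / r ^ 3 := by
  have hN0 : N ≠ 0 := norm_pos_iff.1 (hr.trans_le hN)
  have hP0 : P ≠ 0 := norm_pos_iff.1 (hr.trans_le hP)
  have key : A / P ^ 2 - D / N ^ 2 =
      (A - D) / P ^ 2 + (-(D * (P - N) / (N * P ^ 2)) - D * (P - N) / (N ^ 2 * P)) := by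
    field_simp
    ring
  have h₁ : ‖(A - D) / P ^ 2‖ ≤ ‖A - D‖ / r ^ 2 := by
    rw [norm_div, norm_pow]
    gcongr
  have h₂ : ‖D * (P - N) / (N * P ^ 2)‖ ≤ ‖D‖ * ‖P - N‖ / (r * r ^ 2) := by
    rw [norm_div, norm_mul, norm_mul, norm_pow]
    gcongr
  have h₃ : ‖D * (P - N) / (N ^ 2 * P)‖ ≤ ‖D‖ * ‖P - N‖ / (r ^ 2 * r) := by
    rw [norm_div, norm_mul, norm_mul, norm_pow]
    gcongr
  calc ‖A / P ^ 2 - D / N ^ 2‖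
      ≤ ‖(A - D) / P ^ 2‖ + (‖D * (P - N) / (N * P ^ 2)‖ + ‖D * (P - N) / (N ^ 2 * P)‖) := by
        rw [key]
        refine (norm_add_le _ _).trans (add_le_add_right ((norm_sub_le _ _).trans ?_) _)
        rw [norm_neg]
    _ ≤ ‖A - D‖ / r ^ 2 + (‖D‖ * ‖P - N‖ / (r * r ^ 2) + ‖D‖ * ‖P - N‖ / (r ^ 2 * r)) := by
        gcongr
    _ = _ := by
        field_simp
        ring

lemma norm_det_fin_two_le {S : Matrix (Fin 2) (Fin 2) ℂ} {M : ℝ} (hS : ∀ j k, ‖S j k‖ ≤ M) :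
    ‖S.det‖ ≤ 2 * M ^ 2 := by
  have hM : 0 ≤ M := (norm_nonneg _).trans (hS 0 0)
  rw [det_fin_two]
  calc ‖S 0 0 * S 1 1 - S 0 1 * S 1 0‖
      ≤ ‖S 0 0‖ * ‖S 1 1‖ + ‖S 0 1‖ * ‖S 1 0‖ := by
        simpa only [norm_mul] using norm_sub_le (S 0 0 * S 1 1) (S 0 1 * S 1 0)
    _ ≤ M * M + M * M := by gcongr <;> exact hS _ _
    _ = _ := by ring

lemma norm_det_add_diagonal_sub_det_le {S : Matrix (Fin 2) (Fin 2) ℂ} {M lam δ : ℝ}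
    (hlam : 0 ≤ lam) (hS : ∀ j k, ‖S j k‖ ≤ M) :
    ‖(S + (2 * lam : ℂ) • Matrix.diagonal ![(-1 : ℂ), (δ : ℂ) ^ 2]).det - S.det‖ ≤
      2 * lam * δ ^ 2 * M + 2 * lam * M + 4 * lam ^ 2 * δ ^ 2 := by
  have key : (S + (2 * lam : ℂ) • Matrix.diagonal ![(-1 : ℂ), (δ : ℂ) ^ 2]).det - S.det =
      ((2 * lam * δ ^ 2 : ℝ) : ℂ) * S 0 0 - ((2 * lam : ℝ) : ℂ) * S 1 1 -
        ((4 * lam ^ 2 * δ ^ 2 : ℝ) : ℂ) := by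
    simp [det_fin_two]
    ring
  rw [key]
  refine (norm_sub_le _ _).trans (add_le_add ((norm_sub_le _ _).trans (add_le_add ?_ ?_)) ?_)
  · rw [norm_mul, Complex.norm_of_nonneg (by positivity)]
    gcongr
    exact hS _ _
  · rw [norm_mul, Complex.norm_of_nonneg (by positivity)]
    gcongr
    exact hS _ _
  · rw [Complex.norm_of_nonneg (by positivity)]

/-- 2×2 determinant-difference estimate from the toymodel error
analysis. For every `K > 0` there is `C > 0` such that for all `λ > 0`, `0 < δ ≤ 1/2`,
every `S ∈ ℂ^{2×2}` with `Re⟨u,Su⟩ ≥ (λ/2)‖u‖²` and `|S_{jk}| ≤ K(λ + 1/λ)`,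
`X = 2λ diag(-1, δ²)`, and `v = (δw, 1)ᵗ` with `|w| ≤ 1`:
`⟨v,Xv⟩ = 2λδ²(1-|w|²) ≥ 0`, `Re⟨v,Sv⟩` and `Re⟨v,(S+X)v⟩` are `≥ (λ/2)‖v‖² > 0`, and
`|det(S+X)/⟨v,(S+X)v⟩² - det S/⟨v,Sv⟩²| ≤ C(1+λ⁻²)(1+δ²(1+λ⁻²))`. -/
theorem toymodel_det_difference_estimate (K : ℝ) (hK : 0 < K) :
    ∃ C : ℝ, 0 < C ∧
      ∀ (lam : ℝ), 0 < lam →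
      ∀ (δ : ℝ), 0 < δ → δ ≤ 1 / 2 →
      ∀ S : Matrix (Fin 2) (Fin 2) ℂ,
        (∀ u : Fin 2 → ℂ, lam / 2 * ∑ j, ‖u j‖ ^ 2 ≤ (star u ⬝ᵥ (S *ᵥ u)).re) →
        (∀ j k : Fin 2, ‖S j k‖ ≤ K * (lam + 1 / lam)) →
      ∀ w : ℂ, ‖w‖ ≤ 1 →
        (star ![(δ : ℂ) * w, 1] ⬝ᵥ
            (((2 * lam : ℂ) • Matrix.diagonal ![(-1 : ℂ), (δ : ℂ) ^ 2]) *ᵥ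
              ![(δ : ℂ) * w, 1])) =
          ((2 * lam * δ ^ 2 * (1 - ‖w‖ ^ 2) : ℝ) : ℂ) ∧
        (0 : ℝ) ≤ 2 * lam * δ ^ 2 * (1 - ‖w‖ ^ 2) ∧
        (0 < lam / 2 * ∑ j, ‖(![(δ : ℂ) * w, 1]) j‖ ^ 2) ∧
        (lam / 2 * ∑ j, ‖(![(δ : ℂ) * w, 1]) j‖ ^ 2 ≤
          (star ![(δ : ℂ) * w, 1] ⬝ᵥ (S *ᵥ ![(δ : ℂ) * w, 1])).re) ∧
        (lam / 2 * ∑ j, ‖(![(δ : ℂ) * w, 1]) j‖ ^ 2 ≤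
          (star ![(δ : ℂ) * w, 1] ⬝ᵥ
            ((S + (2 * lam : ℂ) • Matrix.diagonal ![(-1 : ℂ), (δ : ℂ) ^ 2]) *ᵥ
              ![(δ : ℂ) * w, 1])).re) ∧
        ‖
            ((S + (2 * lam : ℂ) • Matrix.diagonal ![(-1 : ℂ), (δ : ℂ) ^ 2]).det /
                (star ![(δ : ℂ) * w, 1] ⬝ᵥ
                  ((S + (2 * lam : ℂ) • Matrix.diagonal ![(-1 : ℂ), (δ : ℂ) ^ 2]) *ᵥ
                    ![(δ : ℂ) * w, 1])) ^ 2 -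
              S.det /
                (star ![(δ : ℂ) * w, 1] ⬝ᵥ (S *ᵥ ![(δ : ℂ) * w, 1])) ^ 2)‖ ≤
          C * (1 + lam⁻¹ ^ 2) * (1 + δ ^ 2 * (1 + lam⁻¹ ^ 2)) := by
  refine ⟨16 * K + 16 + 64 * K ^ 2, by positivity, ?_⟩
  intro lam hlam δ hδ hδ2 S hre hS w hw
  have hform : star ![(δ : ℂ) * w, 1] ⬝ᵥ
      (((2 * lam : ℂ) • Matrix.diagonal ![(-1 : ℂ), (δ : ℂ) ^ 2]) *ᵥ ![(δ : ℂ) * w, 1]) =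
        ((2 * lam * δ ^ 2 * (1 - ‖w‖ ^ 2) : ℝ) : ℂ) := by
    have hconj := Complex.conj_mul' w
    simp [dotProduct, Matrix.mulVec, Fin.sum_univ_two]
    linear_combination (-2 * lam * δ ^ 2 : ℂ) * hconj
  have hw2 : ‖w‖ ^ 2 ≤ 1 := pow_le_one₀ (norm_nonneg w) hw
  have hnonneg : 0 ≤ 2 * lam * δ ^ 2 * (1 - ‖w‖ ^ 2) :=
    mul_nonneg (by positivity) (sub_nonneg.2 hw2)
  have hlower : lam / 2 ≤ lam / 2 * ∑ j, ‖(![(δ : ℂ) * w, 1]) j‖ ^ 2 := by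
    apply le_mul_of_one_le_right (by positivity)
    rw [Fin.sum_univ_two]
    simp [mul_nonneg]
  generalize ![(δ : ℂ) * w, 1] = v at *
  have hadd : star v ⬝ᵥ ((S + (2 * lam : ℂ) • Matrix.diagonal ![(-1 : ℂ), (δ : ℂ) ^ 2]) *ᵥ v) =
      star v ⬝ᵥ (S *ᵥ v) + ((2 * lam * δ ^ 2 * (1 - ‖w‖ ^ 2) : ℝ) : ℂ) := by
    rw [add_mulVec, dotProduct_add, hform]
  have hSv := hre v
  have hSXv : lam / 2 * ∑ j, ‖v j‖ ^ 2 ≤ (star v ⬝ᵥ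
      ((S + (2 * lam : ℂ) • Matrix.diagonal ![(-1 : ℂ), (δ : ℂ) ^ 2]) *ᵥ v)).re := by
    rw [hadd, Complex.add_re, Complex.ofReal_re]
    linarith
  refine ⟨hform, hnonneg, (half_pos hlam).trans_le hlower, hSv, hSXv, ?_⟩
  have hpert : ‖star v ⬝ᵥ ((S + (2 * lam : ℂ) • Matrix.diagonal ![(-1 : ℂ), (δ : ℂ) ^ 2]) *ᵥ v) -
      star v ⬝ᵥ (S *ᵥ v)‖ ≤ 2 * lam * δ ^ 2 := by
    rw [hadd, add_sub_cancel_left, Complex.norm_of_nonneg hnonneg]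
    exact mul_le_of_le_one_right (by positivity) (by linarith [sq_nonneg ‖w‖])
  have hδsq : δ ^ 2 ≤ 1 := pow_le_one₀ hδ.le (by linarith)
  obtain ⟨μ, hμ⟩ : ∃ μ, μ = 1 + lam⁻¹ ^ 2 := ⟨_, rfl⟩
  have hμ1 : 1 ≤ μ := by rw [hμ]; linarith [sq_nonneg lam⁻¹]
  have hM : K * (lam + 1 / lam) = K * lam * μ := by
    rw [hμ]
    field_simp
  rw [hM] at hS
  rw [← hμ]
  refine (norm_div_sq_sub_div_sq_le (half_pos hlam)
    (hlower.trans (hSv.trans (Complex.re_le_norm _)))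
    (hlower.trans (hSXv.trans (Complex.re_le_norm _)))).trans ?_
  calc _ ≤ (2 * lam * δ ^ 2 * (K * lam * μ) + 2 * lam * (K * lam * μ) + 4 * lam ^ 2 * δ ^ 2) /
          (lam / 2) ^ 2 +
        2 * (2 * (K * lam * μ) ^ 2) * (2 * lam * δ ^ 2) / (lam / 2) ^ 3 := by
        gcongr
        · exact norm_det_add_diagonal_sub_det_le hlam.le hS
        · exact norm_det_fin_two_le hS
    _ = 8 * K * μ * δ ^ 2 + 8 * K * μ + 16 * δ ^ 2 + 64 * K ^ 2 * μ * (δ ^ 2 * μ) := by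
        field_simp
        ring
    _ ≤ 8 * K * μ * 1 + 8 * K * μ + 16 * μ + 64 * K ^ 2 * μ * (δ ^ 2 * μ) := by
        gcongr
        exact hδsq.trans hμ1
    _ ≤ (16 * K + 16) * μ * (1 + δ ^ 2 * μ) + 64 * K ^ 2 * μ * (1 + δ ^ 2 * μ) := by
        have h : 0 ≤ (16 * K + 16) * μ * (δ ^ 2 * μ) := by positivity
        have h' : 0 ≤ 64 * K ^ 2 * μ := by positivity
        linarith
    _ = _ := by ring
end
end
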